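/- arXiv:2002.00304 — 3 statements merged into one kernel-verified Lean document; each statement's English description precedes it below -/
import Mathlib

section
/- Let R be an alternative ring with a nontrivial idempotent e₁ satisfying conditions (i) and (ii), let n ≥ 2 be an integer and let D : R → R be a multiplicative Lie n-derivation. Then D is almost additive: for all a, b ∈ R there exists z ∈ Z(R) such that D(a + b) = D(a) + D(b) + z. -/
/-- The commutative center of a (possibly non-associative, non-unital) ring. -/
def rctr (R : Type*) [NonUnitalNonAssocRing R] : Set R := {z | ∀ x, z * x = x * z}

/-- `R` is an alternative ring. -/
def IsAlt (R : Type*) [NonUnitalNonAssocRing R] : Prop :=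
  ∀ x y : R, (x * x) * y = x * (x * y) ∧ (y * x) * x = y * (x * x)

/-- Peirce components relative to an idempotent `e`. -/
def P11 {R : Type*} [NonUnitalNonAssocRing R] (e : R) : Set R := {x | e * x = x ∧ x * e = x}
def P12 {R : Type*} [NonUnitalNonAssocRing R] (e : R) : Set R := {x | e * x = x ∧ x * e = 0}
def P21 {R : Type*} [NonUnitalNonAssocRing R] (e : R) : Set R := {x | e * x = 0 ∧ x * e = x}
def P22 {R : Type*} [NonUnitalNonAssocRing R] (e : R) : Set R := {x | e * x = 0 ∧ x * e = 0}

/-- The iterated commutator `p_n`: `p_1(x) = x`,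
`p_n(x_1,…,x_n) = [p_{n-1}(x_1,…,x_{n-1}), x_n]`. -/
def pn {R : Type*} [NonUnitalNonAssocRing R] : (n : ℕ) → (Fin n → R) → R
  | 0, _ => 0
  | 1, x => x 0
  | (m+2), x =>
      pn (m+1) (fun i => x i.castSucc) * x (Fin.last (m+1))
        - x (Fin.last (m+1)) * pn (m+1) (fun i => x i.castSucc)

/-- A (not necessarily additive) map `D` is a multiplicative Lie `n`-derivation. -/
def IsMultLieNDeriv {R : Type*} [NonUnitalNonAssocRing R] (n : ℕ) (D : R → R) : Prop :=
  ∀ x : Fin n → R, D (pn n x) = ∑ i : Fin n, pn n (Function.update x i (D (x i)))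


section helpers
variable {R : Type*} [NonUnitalNonAssocRing R]

/-- linearized left alternativity -/
lemma alt_l (halt : IsAlt R) (x y z : R) :
    (x * y) * z - x * (y * z) = -((y * x) * z - y * (x * z)) := by
  have h := (halt (x + y) z).1
  have h1 := (halt x z).1
  have h2 := (halt y z).1
  simp only [add_mul, mul_add] at h
  rw [h1, h2] at h
  rw [← sub_eq_zero] at h ⊢
  rw [← h]; abel

/-- linearized right alternativity -/
lemma alt_r (halt : IsAlt R) (x y z : R) :
    (x * y) * z - x * (y * z) = -((x * z) * y - x * (z * y)) := by
  have h := (halt (y + z) x).2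
  have h1 := (halt y x).2
  have h2 := (halt z x).2
  simp only [add_mul, mul_add] at h
  rw [h1, h2] at h
  rw [← sub_eq_zero] at h ⊢
  rw [← h]; abel

lemma alt_skew (halt : IsAlt R) (x y z : R) :
    (x * y) * z - x * (y * z) = -((y * x) * z - y * (x * z)) ∧
    (x * y) * z - x * (y * z) = -((x * z) * y - x * (z * y)) ∧
    (x * y) * z - x * (y * z) = (y * z) * x - y * (z * x) ∧
    (x * y) * z - x * (y * z) = (z * x) * y - z * (x * y) ∧
    (x * y) * z - x * (y * z) = -((z * y) * x - z * (y * x)) := by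
  refine ⟨alt_l halt x y z, alt_r halt x y z, ?_, ?_, ?_⟩
  · rw [alt_l halt x y z, alt_r halt y x z, neg_neg]
  · rw [alt_r halt x y z, alt_l halt x z y, neg_neg]
  · rw [alt_l halt x y z, alt_r halt y x z, neg_neg, alt_l halt y z x]

lemma m12_21 (halt : IsAlt R) {e x y : R} (hx : x ∈ P12 e) (hy : y ∈ P21 e) :
    x * y ∈ P11 e := by
  obtain ⟨h1, h2⟩ := hx
  obtain ⟨h3, h4⟩ := hy
  have h := alt_skew halt e x y
  simp only [h1, h2, h3, h4, mul_zero, zero_mul] at h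
  constructor <;> grind

lemma m21_12 (halt : IsAlt R) {e x y : R} (hx : x ∈ P21 e) (hy : y ∈ P12 e) :
    x * y ∈ P22 e := by
  obtain ⟨h1, h2⟩ := hx
  obtain ⟨h3, h4⟩ := hy
  have h := alt_skew halt e x y
  simp only [h1, h2, h3, h4, mul_zero, zero_mul] at h
  constructor <;> grind

lemma m12_12 (halt : IsAlt R) {e x y : R} (hx : x ∈ P12 e) (hy : y ∈ P12 e) :
    x * y ∈ P21 e := by
  obtain ⟨h1, h2⟩ := hx
  obtain ⟨h3, h4⟩ := hy
  have h := alt_skew halt e x y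
  simp only [h1, h2, h3, h4, mul_zero, zero_mul] at h
  constructor <;> grind

lemma m21_21 (halt : IsAlt R) {e x y : R} (hx : x ∈ P21 e) (hy : y ∈ P21 e) :
    x * y ∈ P12 e := by
  obtain ⟨h1, h2⟩ := hx
  obtain ⟨h3, h4⟩ := hy
  have h := alt_skew halt e x y
  simp only [h1, h2, h3, h4, mul_zero, zero_mul] at h
  constructor <;> grind

lemma m11_21 (halt : IsAlt R) {e x y : R} (hx : x ∈ P11 e) (hy : y ∈ P21 e) :
    x * y = 0 ∧ y * x ∈ P21 e := by
  obtain ⟨h1, h2⟩ := hx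
  obtain ⟨h3, h4⟩ := hy
  have h := alt_skew halt e x y
  simp only [h1, h2, h3, h4, mul_zero, zero_mul] at h
  refine ⟨?_, ?_, ?_⟩ <;> grind

lemma m22_21 (halt : IsAlt R) {e x y : R} (hx : x ∈ P22 e) (hy : y ∈ P21 e) :
    y * x = 0 ∧ x * y ∈ P21 e := by
  obtain ⟨h1, h2⟩ := hx
  obtain ⟨h3, h4⟩ := hy
  have h := alt_skew halt e x y
  simp only [h1, h2, h3, h4, mul_zero, zero_mul] at h
  refine ⟨?_, ?_, ?_⟩ <;> grind

lemma m11_12 (halt : IsAlt R) {e x y : R} (hx : x ∈ P11 e) (hy : y ∈ P12 e) :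
    y * x = 0 ∧ x * y ∈ P12 e := by
  obtain ⟨h1, h2⟩ := hx
  obtain ⟨h3, h4⟩ := hy
  have h := alt_skew halt e x y
  simp only [h1, h2, h3, h4, mul_zero, zero_mul] at h
  refine ⟨?_, ?_, ?_⟩ <;> grind

lemma m22_12 (halt : IsAlt R) {e x y : R} (hx : x ∈ P22 e) (hy : y ∈ P12 e) :
    x * y = 0 ∧ y * x ∈ P12 e := by
  obtain ⟨h1, h2⟩ := hx
  obtain ⟨h3, h4⟩ := hy
  have h := alt_skew halt e x y
  simp only [h1, h2, h3, h4, mul_zero, zero_mul] at h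
  refine ⟨?_, ?_, ?_⟩ <;> grind

/-- right commutation with `e` -/
def adr (e : R) : R →+ R where
  toFun u := u * e - e * u
  map_zero' := by simp
  map_add' x y := by simp only [add_mul, mul_add]; abel

lemma adr_apply (e u : R) : adr e u = u * e - e * u := rfl

lemma e_facts (halt : IsAlt R) {e : R} (he : e * e = e) (u : R) :
    e * (e * u) = e * u ∧ (u * e) * e = u * e ∧ (e * u) * e = e * (u * e) := by
  have h1 := halt e u
  have h2 := alt_l halt e u e
  rw [he] at h1
  rw [(halt e u).2, he, sub_self, neg_zero, sub_eq_zero] at h2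
  exact ⟨h1.1.symm, h1.2, h2⟩

lemma adr_cube (halt : IsAlt R) {e : R} (he : e * e = e) (u : R) :
    adr e (adr e (adr e u)) = adr e u := by
  obtain ⟨h1, h2, h3⟩ := e_facts halt he u
  obtain ⟨h4, h5, h6⟩ := e_facts halt he (u * e)
  simp only [adr_apply, sub_mul, mul_sub, h1, h2, h3, h4, h5, h6]
  abel

lemma adr_dec (halt : IsAlt R) {e : R} (he : e * e = e) (u : R) :
    ∃ p ∈ P12 e, ∃ q ∈ P21 e, adr e u = p + q := by
  obtain ⟨h1, h2, h3⟩ := e_facts halt he u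
  obtain ⟨h4, h5, h6⟩ := e_facts halt he (u * e)
  refine ⟨e * (u * e) - e * u, ⟨?_, ?_⟩, u * e - e * (u * e), ⟨?_, ?_⟩, ?_⟩
  · simp only [sub_mul, mul_sub, h1, h2, h3, h4, h5, h6]
  · simp only [sub_mul, mul_sub, h1, h2, h3, h4, h5, h6, sub_self]
  · simp only [sub_mul, mul_sub, h1, h2, h3, h4, h5, h6, sub_self]
  · simp only [sub_mul, mul_sub, h1, h2, h3, h4, h5, h6]
  · rw [adr_apply]; abel

lemma comm_dec (halt : IsAlt R) {e : R} (he : e * e = e) {t : R} (ht : adr e t = 0) :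
    ∃ a ∈ P11 e, ∃ b ∈ P22 e, t = a + b := by
  obtain ⟨h1, h2, h3⟩ := e_facts halt he t
  rw [adr_apply, sub_eq_zero] at ht
  refine ⟨t * e, ⟨?_, h2⟩, t - t * e, ⟨?_, ?_⟩, by abel⟩
  · rw [← h3, ← ht, h2]
  · rw [mul_sub, ← h3, ← ht, h2, sub_self]
  · rw [sub_mul, h2, sub_self]

lemma center12 (halt : IsAlt R) {e : R} (he : e * e = e)
    (hc : ∀ a ∈ P11 e, ∀ b ∈ P22 e,
      (∀ x ∈ P12 e, (a + b) * x = x * (a + b)) → a + b ∈ rctr R)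
    {t : R} (ht : adr e t = 0) (h : ∀ x ∈ P12 e, adr e (t * x - x * t) = 0) : t ∈ rctr R := by
  obtain ⟨a, ha, b, hb, rfl⟩ := comm_dec halt he ht
  refine hc a ha b hb fun x hx => ?_
  have h0 := h x hx
  obtain ⟨k1, k2, k3⟩ := m11_12 halt ha hx
  obtain ⟨l1, l2, l3⟩ := m22_12 halt hb hx
  simp only [adr_apply, add_mul, mul_add, sub_mul, mul_sub, k1, k2, k3, l1, l2, l3,
    zero_mul, mul_zero] at h0 ⊢
  grind

lemma center21 (halt : IsAlt R) {e : R} (he : e * e = e)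
    (hc : ∀ a ∈ P11 e, ∀ b ∈ P22 e,
      (∀ x ∈ P21 e, (a + b) * x = x * (a + b)) → a + b ∈ rctr R)
    {t : R} (ht : adr e t = 0) (h : ∀ x ∈ P21 e, adr e (t * x - x * t) = 0) : t ∈ rctr R := by
  obtain ⟨a, ha, b, hb, rfl⟩ := comm_dec halt he ht
  refine hc a ha b hb fun x hx => ?_
  have h0 := h x hx
  obtain ⟨k1, k2, k3⟩ := m11_21 halt ha hx
  obtain ⟨l1, l2, l3⟩ := m22_21 halt hb hx
  simp only [adr_apply, add_mul, mul_add, sub_mul, mul_sub, k1, k2, k3, l1, l2, l3,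
    zero_mul, mul_zero] at h0 ⊢
  grind

/-- `pn` is an additive function of the first commutator. -/
lemma pn_factor (m : ℕ) (w : Fin (m + 2) → R) :
    ∃ L : R →+ R, ∀ w' : Fin (m + 2) → R, (∀ i : Fin (m + 2), 2 ≤ i.val → w' i = w i) →
      pn (m + 2) w' = L (w' 0 * w' 1 - w' 1 * w' 0) := by
  induction m with
  | zero => exact ⟨AddMonoidHom.id R, fun w' _ => rfl⟩
  | succ m ih =>
    obtain ⟨L, hL⟩ := ih (fun i => w i.castSucc)
    refine ⟨(adr (w (Fin.last (m + 2)))).comp L, fun w' hw => ?_⟩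
    have h1 := hL (fun i => w' i.castSucc) (fun i hi => hw _ (by simpa using hi))
    have h2 := hw (Fin.last (m + 2)) (by simp)
    rw [pn, h1, h2]
    rfl

lemma pn_e (m : ℕ) (e : R) (w : Fin (m + 2) → R)
    (hw : ∀ i : Fin (m + 2), 2 ≤ i.val → w i = e) :
    pn (m + 2) w = (adr e)^[m] (w 0 * w 1 - w 1 * w 0) := by
  induction m with
  | zero => rfl
  | succ m ih =>
    have h1 := ih (fun i => w i.castSucc) (fun i hi => hw _ (by simpa using hi))
    have h2 := hw (Fin.last (m + 2)) (by simp)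
    rw [pn, h1, h2, Function.iterate_succ_apply']
    rfl

lemma deriv_form (m : ℕ) (e : R) (D : R → R) (hD : IsMultLieNDeriv (m + 2) D) :
    ∃ Ψ : R →+ R, ∀ x y : R, D ((adr e)^[m] (x * y - y * x)) =
      (adr e)^[m] (D x * y - y * D x) + (adr e)^[m] (x * D y - D y * x) +
        Ψ (x * y - y * x) := by
  choose L hL using fun i : Fin m =>
    pn_factor (R := R) m (Function.update (fun _ => e) i.succ.succ (D e))
  refine ⟨∑ i, L i, fun x y => ?_⟩
  let v : Fin (m + 2) → R := Fin.cons x (Fin.cons y fun _ => e)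
  have hv : ∀ i : Fin (m + 2), 2 ≤ i.val → v i = e := by
    intro i hi
    induction i using Fin.cases with
    | zero => simp at hi
    | succ i =>
      induction i using Fin.cases with
      | zero => simp at hi
      | succ i => simp [v]
  have hv0 : v 0 = x := rfl
  have hv1 : v 1 = y := rfl
  have h := hD v
  rw [pn_e m e v hv, hv0, hv1, Fin.sum_univ_succ, Fin.sum_univ_succ] at h
  rw [h, ← add_assoc]
  congr 1
  · congr 1
    · rw [pn_e m e]
      · simp [hv0, hv1]
      · intro i hi
        rw [Function.update_of_ne, hv i hi]
        rintro rfl; simp at hi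
    · have : (Fin.succ 0 : Fin (m + 2)) = 1 := rfl
      rw [this, pn_e m e]
      · simp [hv0, hv1]
      · intro i hi
        rw [Function.update_of_ne, hv i hi]
        rintro rfl; simp at hi
  · rw [AddMonoidHom.finsetSum_apply]
    refine Finset.sum_congr rfl fun i _ => ?_
    have hi2 : v i.succ.succ = e := hv _ (by simp)
    rw [hL i, hi2]
    · rw [Function.update_of_ne (by exact (Fin.succ_ne_zero _).symm), Function.update_of_ne, hv0, hv1]
      intro h
      have := congrArg Fin.val h
      simp at this
    · intro j hj
      by_cases hji : j = i.succ.succ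
      · subst hji; rw [hi2]; simp
      · rw [Function.update_of_ne hji, Function.update_of_ne hji, hv j hj]

lemma adr_iter (halt : IsAlt R) {e : R} (he : e * e = e) (m : ℕ) (u : R) :
    (adr e)^[m] (adr e ((adr e)^[m] u)) = adr e u := by
  induction m generalizing u with
  | zero => rfl
  | succ m ih =>
    rw [Function.iterate_succ_apply, Function.iterate_succ_apply', adr_cube halt he, ih]

/-- normalised form of the derivation identity -/
lemma deriv_norm (halt : IsAlt R) {e : R} (he : e * e = e)
    (m : ℕ) (D : R → R) (hD : IsMultLieNDeriv (m + 2) D) :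
    ∃ Ψ : R →+ R, ∀ x y : R, D (adr e (x * y - y * x)) =
      adr e (D x * y - y * D x) + adr e (x * D y - D y * x) + Ψ (x * y - y * x) := by
  obtain ⟨Ψ, h⟩ := deriv_form m e D hD
  obtain ⟨T, hT⟩ : ∃ T : R →+ R, ∀ u, (adr e)^[m] u = T u := by
    clear h hD Ψ
    induction m with
    | zero => exact ⟨AddMonoidHom.id R, fun u => rfl⟩
    | succ m ih =>
      obtain ⟨T, hT⟩ := ih
      exact ⟨(adr e).comp T, fun u => by
        rw [Function.iterate_succ_apply', hT]; rfl⟩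
  have hTT : ∀ u, T (adr e (T u)) = adr e u := fun u => by
    rw [← hT, ← hT, adr_iter halt he]
  simp only [hT] at h
  let B : R →+ R := adr (D e)
  refine ⟨(T.comp (adr e)).comp Ψ + (T.comp B).comp T + (Ψ.comp (adr e)).comp T, fun x y => ?_⟩
  have h2 : D (T (adr e (T (x * y - y * x)))) = T (adr e (D (T (x * y - y * x)))) +
      T (adr (D e) (T (x * y - y * x))) + Ψ (adr e (T (x * y - y * x))) :=
    h (T (x * y - y * x)) e
  rw [hTT, h x y, map_add, map_add, map_add, map_add, hTT, hTT] at h2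
  simp only [AddMonoidHom.add_apply, AddMonoidHom.comp_apply, B]
  rw [h2]
  abel

end helpers

theorem stmt0 {R : Type*} [NonUnitalNonAssocRing R] (halt : IsAlt R)
    (e₁ : R) (he : e₁ * e₁ = e₁) (hne : e₁ ≠ 0)
    (hnu : ¬ ∀ x : R, e₁ * x = x ∧ x * e₁ = x)
    (hcondi : ∀ a ∈ P11 e₁, ∀ b ∈ P22 e₁,
      (∀ x ∈ P12 e₁, (a + b) * x = x * (a + b)) → a + b ∈ rctr R)
    (hcondii : ∀ a ∈ P11 e₁, ∀ b ∈ P22 e₁,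
      (∀ x ∈ P21 e₁, (a + b) * x = x * (a + b)) → a + b ∈ rctr R)
    (n : ℕ) (hn : 2 ≤ n) (D : R → R) (hD : IsMultLieNDeriv n D) :
    ∀ a b : R, ∃ z ∈ rctr R, D (a + b) = D a + D b + z := by
  obtain ⟨m, rfl⟩ : ∃ m, n = m + 2 := ⟨n - 2, by omega⟩
  obtain ⟨Ψ, hE⟩ := deriv_norm halt he m D hD
  clear hD
  set A := adr e₁ with hA
  have hA12 : ∀ x ∈ P12 e₁, A x = -x := fun x hx => by rw [hA, adr_apply, hx.1, hx.2, zero_sub]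
  have hA21 : ∀ x ∈ P21 e₁, A x = x := fun x hx => by rw [hA, adr_apply, hx.1, hx.2, sub_zero]
  have hA11 : ∀ x ∈ P11 e₁, A x = 0 := fun x hx => by rw [hA, adr_apply, hx.1, hx.2, sub_self]
  have hA22 : ∀ x ∈ P22 e₁, A x = 0 := fun x hx => by rw [hA, adr_apply, hx.1, hx.2, sub_self]
  have hAe : A e₁ = 0 := hA11 _ ⟨he, he⟩
  -- a step isolating the defect of additivity
  have defect : ∀ a b y, D (A ((a + b) * y - y * (a + b))) =
      D (A (a * y - y * a)) + D (A (b * y - y * b)) →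
      A ((D (a + b) - D a - D b) * y - y * (D (a + b) - D a - D b)) = 0 := by
    intro a b y h
    rw [hE, hE, hE] at h
    simp only [add_mul, mul_add, sub_mul, mul_sub, map_add, map_sub] at h ⊢
    rw [← sub_eq_zero] at h
    rw [← h]; abel
  have D0 : D 0 = 0 := by
    have h := hE 0 0
    simpa using h
  have adr_zero : ∀ t, A (t * e₁ - e₁ * t) = 0 → A t = 0 := by
    intro t h
    have h' : A (A t) = 0 := h
    rw [hA, ← adr_cube halt he t, ← hA, h', map_zero]
  have hneg12 : ∀ x ∈ P12 e₁, -x ∈ P12 e₁ := fun x hx =>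
    ⟨by rw [mul_neg, hx.1], by rw [neg_mul, hx.2, neg_zero]⟩
  have hneg21 : ∀ x ∈ P21 e₁, -x ∈ P21 e₁ := fun x hx =>
    ⟨by rw [mul_neg, hx.1, neg_zero], by rw [neg_mul, hx.2]⟩
  have hadd12 : ∀ x ∈ P12 e₁, ∀ y ∈ P12 e₁, x + y ∈ P12 e₁ := fun x hx y hy =>
    ⟨by rw [mul_add, hx.1, hy.1], by rw [add_mul, hx.2, hy.2, add_zero]⟩
  have hadd21 : ∀ x ∈ P21 e₁, ∀ y ∈ P21 e₁, x + y ∈ P21 e₁ := fun x hx y hy =>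
    ⟨by rw [mul_add, hx.1, hy.1, add_zero], by rw [add_mul, hx.2, hy.2]⟩
  have hdiag : ∀ x ∈ P12 e₁, ∀ y ∈ P21 e₁, A (x * y - y * x) = 0 := fun x hx y hy => by
    rw [map_sub, hA11 _ (m12_21 halt hx hy), hA22 _ (m21_12 halt hy hx), sub_zero]
  have hdiag' : ∀ x ∈ P21 e₁, ∀ y ∈ P12 e₁, A (x * y - y * x) = 0 := fun x hx y hy => by
    rw [map_sub, hA22 _ (m21_12 halt hx hy), hA11 _ (m12_21 halt hy hx), sub_zero]
  -- almost additivity at `e₁ + a₁₂`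
  have e12 : ∀ a ∈ P12 e₁, ∃ z ∈ rctr R, D (e₁ + a) = D e₁ + D a + z := by
    intro a ha
    refine ⟨D (e₁ + a) - D e₁ - D a, ?_, by abel⟩
    refine center21 halt he hcondii (adr_zero _ (defect _ _ _ ?_)) fun x hx => defect _ _ _ ?_
    · rw [add_mul, mul_add, add_sub_add_comm, sub_self, zero_add, map_zero, D0, zero_add]
    · rw [add_mul, mul_add, add_sub_add_comm, map_add, hdiag a ha x hx, D0]
      simp
  have e21 : ∀ a ∈ P21 e₁, ∃ z ∈ rctr R, D (e₁ + a) = D e₁ + D a + z := by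
    intro a ha
    refine ⟨D (e₁ + a) - D e₁ - D a, ?_, by abel⟩
    refine center12 halt he hcondi (adr_zero _ (defect _ _ _ ?_)) fun x hx => defect _ _ _ ?_
    · rw [add_mul, mul_add, add_sub_add_comm, sub_self, zero_add, map_zero, D0, zero_add]
    · rw [add_mul, mul_add, add_sub_add_comm, map_add, hdiag' a ha x hx, D0]
      simp
  -- bilinear expansion
  have expand : ∀ a b, (∃ z ∈ rctr R, D (e₁ + a) = D e₁ + D a + z) →
      (∃ z ∈ rctr R, D (e₁ + b) = D e₁ + D b + z) →
      D (A ((e₁ + a) * (e₁ + b) - (e₁ + b) * (e₁ + a))) =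
        D (A (e₁ * b - b * e₁)) + D (A (a * e₁ - e₁ * a)) + D (A (a * b - b * a)) := by
    rintro a b ⟨z, hz, h1⟩ ⟨w, hw, h2⟩
    have h0 : (0 : R) = A (D e₁ * e₁ - e₁ * D e₁) + A (e₁ * D e₁ - D e₁ * e₁)
        + Ψ (e₁ * e₁ - e₁ * e₁) := by
      rw [← hE, sub_self, map_zero, D0]
    have hz1 := hz (e₁ + b)
    have hw1 := hw (e₁ + a)
    have k1 : D (e₁ + a) * (e₁ + b) - (e₁ + b) * D (e₁ + a) =
        (D e₁ + D a) * (e₁ + b) - (e₁ + b) * (D e₁ + D a) := by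
      rw [h1, add_mul _ z, mul_add _ _ z, hz1]; abel
    have k2 : (e₁ + a) * D (e₁ + b) - D (e₁ + b) * (e₁ + a) =
        (e₁ + a) * (D e₁ + D b) - (D e₁ + D b) * (e₁ + a) := by
      rw [h2, add_mul _ w, mul_add _ _ w, hw1]; abel
    rw [hE, hE, hE, hE, k1, k2]
    simp only [add_mul, mul_add, map_add, map_sub] at h0 ⊢
    rw [← sub_eq_zero, h0]; abel
  have s12 : ∀ x ∈ P12 e₁, e₁ * x - x * e₁ = x := fun x hx => by rw [hx.1, hx.2, sub_zero]
  have s21 : ∀ x ∈ P21 e₁, e₁ * x - x * e₁ = -x := fun x hx => by rw [hx.1, hx.2, zero_sub]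
  have s12' : ∀ x ∈ P12 e₁, x * e₁ - e₁ * x = -x := fun x hx => by rw [hx.1, hx.2, zero_sub]
  have s21' : ∀ x ∈ P21 e₁, x * e₁ - e₁ * x = x := fun x hx => by rw [hx.1, hx.2, sub_zero]
  have lin : ∀ a b, A ((e₁ + a) * (e₁ + b) - (e₁ + b) * (e₁ + a)) =
      A (e₁ * b - b * e₁) + A (a * e₁ - e₁ * a) + A (a * b - b * a) := by
    intro a b
    rw [← map_add, ← map_add]; congr 1
    simp only [add_mul, mul_add]; abel
  -- additivity on `R₁₂ + R₂₁`
  have mixed : ∀ a ∈ P12 e₁, ∀ b ∈ P21 e₁, D (a + b) = D a + D b := by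
    intro a ha b hb
    have hb' := hneg21 b hb
    have h := expand a (-b) (e12 a ha) (e21 _ hb')
    rw [lin, s21 _ hb', s12' _ ha, hdiag a ha _ hb', D0, add_zero, add_zero, neg_neg,
      hA21 b hb, map_neg, hA12 a ha, neg_neg] at h
    rw [add_comm a b, h, add_comm]
  have hcomm21 : ∀ a ∈ P12 e₁, ∀ b ∈ P12 e₁, a * b - b * a ∈ P21 e₁ := fun a ha b hb => by
    rw [sub_eq_add_neg]
    exact hadd21 _ (m12_12 halt ha hb) _ (hneg21 _ (m12_12 halt hb ha))
  have hcomm12 : ∀ a ∈ P21 e₁, ∀ b ∈ P21 e₁, a * b - b * a ∈ P12 e₁ := fun a ha b hb => by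
    rw [sub_eq_add_neg]
    exact hadd12 _ (m21_21 halt ha hb) _ (hneg12 _ (m21_21 halt hb ha))
  have add12 : ∀ a ∈ P12 e₁, ∀ b ∈ P12 e₁, D (a + b) = D a + D b := by
    intro a ha b hb
    have hb' := hneg12 b hb
    have hc := hcomm21 a ha _ hb'
    have h := expand a (-b) (e12 a ha) (e12 _ hb')
    rw [lin, s12 _ hb', s12' _ ha, hA21 _ hc, map_neg, map_neg, hA12 a ha, hA12 b hb,
      neg_neg, neg_neg, mixed _ (hadd12 b hb a ha) _ hc] at h
    rw [add_comm a b, add_right_cancel h, add_comm]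
  have add21 : ∀ a ∈ P21 e₁, ∀ b ∈ P21 e₁, D (a + b) = D a + D b := by
    intro a ha b hb
    have hb' := hneg21 b hb
    have hc := hneg12 _ (hcomm12 a ha _ hb')
    have h := expand a (-b) (e21 a ha) (e21 _ hb')
    rw [lin, s21 _ hb', s21' _ ha, hA12 _ (hcomm12 a ha _ hb'), neg_neg, hA21 a ha, hA21 b hb,
      add_comm (b + a), mixed _ hc _ (hadd21 b hb a ha), add_comm (D (-_))] at h
    rw [add_comm a b, add_right_cancel h, add_comm]
  have addA : ∀ u v, D (A u + A v) = D (A u) + D (A v) := by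
    intro u v
    obtain ⟨p, hp, q, hq, h1⟩ := adr_dec halt he u
    obtain ⟨p', hp', q', hq', h2⟩ := adr_dec halt he v
    rw [hA, h1, h2, add_add_add_comm, mixed _ (hadd12 p hp p' hp') _ (hadd21 q hq q' hq'),
      mixed p hp q hq, mixed p' hp' q' hq', add12 p hp p' hp', add21 q hq q' hq',
      add_add_add_comm]
  intro a b
  refine ⟨D (a + b) - D a - D b, ?_, by abel⟩
  have key : ∀ y, A ((D (a + b) - D a - D b) * y - y * (D (a + b) - D a - D b)) = 0 := by
    intro y
    refine defect a b y ?_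
    rw [← addA, ← map_add, add_mul, mul_add, add_sub_add_comm]
  exact center12 halt he hcondi (adr_zero _ (key _)) fun x _ => key x
end

section
/- Let R be an alternative ring with a nontrivial idempotent e₁ satisfying conditions (i) and (ii), let n ≥ 2 be an integer and let D : R → R be a multiplicative Lie n-derivation. Then for i ∈ {1,2} and all a, b ∈ R_ii there exists z ∈ Z(R) such that D(a + b) = D(a) + D(b) + z. -/
section aux
variable {R : Type*} [NonUnitalNonAssocRing R]

/-- commutator -/
def br (x y : R) : R := x * y - y * x

/-- right bracket with `c` -/
def ad (c : R) : R →+ R := AddMonoidHom.mulRight c - AddMonoidHom.mulLeft c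

lemma ad_apply (c t : R) : ad c t = t * c - c * t := rfl

/-- iterated right brackets -/
def HH (g : ℕ → R) : ℕ → (R →+ R)
  | 0 => AddMonoidHom.id R
  | k+1 => (ad (g k)).comp (HH g k)

/-- argument vectors -/
def XX (u v : R) (g : ℕ → R) (k : ℕ) : Fin (k+2) → R :=
  fun i => if i.val = 0 then u else if i.val = 1 then v else g (i.val - 2)

lemma pn_XX (u v : R) (g : ℕ → R) (k : ℕ) : pn (k+2) (XX u v g k) = HH g k (br u v) := by
  induction k with
  | zero => simp [pn, XX, HH, br]
  | succ k ih =>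
    have h : (fun i : Fin (k+2) => XX u v g (k+1) i.castSucc) = XX u v g k := by
      funext i; simp [XX]
    rw [pn, h, ih]
    simp [XX, HH, ad_apply]

lemma key (n : ℕ) (hn : 2 ≤ n) (D : R → R) (hD : IsMultLieNDeriv n D) (e : R) :
    ∃ k, 1 ≤ k ∧ ∃ F : R →+ R, ∀ u v, D (HH (fun _ => e) k (br u v)) =
      HH (fun _ => e) k (br (D u) v) + HH (fun _ => e) k (br u (D v)) + F (br u v) := by
  have gen : ∃ k, n = k + 2 ∧ ∃ F : R →+ R, ∀ u v, D (HH (fun _ => e) k (br u v)) =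
      HH (fun _ => e) k (br (D u) v) + HH (fun _ => e) k (br u (D v)) + F (br u v) := by
    obtain ⟨k, rfl⟩ := Nat.exists_eq_add_of_le' hn
    refine ⟨k, rfl, ∑ i : Fin k, HH (Function.update (fun _ => e) i.val (D e)) k, ?_⟩
    intro u v
    have h := hD (XX u v (fun _ => e) k)
    rw [pn_XX, Fin.sum_univ_succ, Fin.sum_univ_succ, ← add_assoc] at h
    rw [h]
    congr 1
    · congr 1
      · rw [← pn_XX]; congr 1; funext i
        refine Fin.cases ?_ (fun i => ?_) i
        · simp [XX]
        · simp [XX, Function.update]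
      · rw [← pn_XX]; congr 1; funext i
        refine Fin.cases ?_ (fun i => ?_) i
        · simp [XX, Function.update]
        · refine Fin.cases ?_ (fun i => ?_) i
          · simp [XX]
          · simp [XX, Function.update, Fin.ext_iff]
    · rw [AddMonoidHom.finsetSum_apply]
      refine Finset.sum_congr rfl fun j _ => ?_
      rw [← pn_XX]; congr 1; funext i
      by_cases hij : i = j.succ.succ
      · subst hij; simp [XX]
      · rw [Function.update_of_ne hij]
        simp only [XX]
        split_ifs with h0 h1
        · rfl
        · rfl
        · rw [Function.update_of_ne]
          intro h2; apply hij; ext; simp; omega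
  obtain ⟨k, hk, F, hF⟩ := gen
  rcases Nat.eq_zero_or_pos k with rfl | hpos
  · have h2 : ∀ u v, D (br u v) = br (D u) v + br u (D v) := by
      intro u v
      subst hk
      have h := hD (XX u v (fun _ => e) 0)
      rw [pn_XX] at h
      simp [HH, pn, XX, br, Function.update] at h
      rw [br, br, br, h]; abel
    refine ⟨1, le_rfl, ad (D e), fun u v => ?_⟩
    have h3 := h2 (br u v) e
    have h4 : ∀ t : R, HH (fun _ => e) 1 t = br t e := fun t => rfl
    have h5 : ∀ t : R, ad (D e) t = br t (D e) := fun t => rfl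
    rw [h4, h4, h4, h5, h3, h2]
    simp only [br, add_mul, mul_add]; abel
  · exact ⟨k, hpos, F, hF⟩

/-- associator -/
def asr (x y z : R) : R := (x * y) * z - x * (y * z)

lemma asr1 (halt : IsAlt R) (x y z : R) : asr x y z = - asr y x z := by
  have h1 := (halt (x+y) z).1
  have h2 := (halt x z).1
  have h3 := (halt y z).1
  simp only [add_mul, mul_add] at h1
  rw [h2, h3] at h1
  simp only [asr]
  rw [← sub_eq_zero] at h1 ⊢
  rw [← h1]; abel

lemma asr2 (halt : IsAlt R) (x y z : R) : asr x y z = - asr x z y := by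
  have h1 := (halt (y+z) x).2
  have h2 := (halt y x).2
  have h3 := (halt z x).2
  simp only [add_mul, mul_add] at h1
  rw [h2, h3] at h1
  simp only [asr]
  rw [← sub_eq_zero] at h1 ⊢
  rw [← h1]; abel

lemma asr_all (halt : IsAlt R) {x y z : R} (h : (x * y) * z = x * (y * z)) :
    (x * z) * y = x * (z * y) ∧ (y * x) * z = y * (x * z) ∧ (y * z) * x = y * (z * x) ∧
    (z * x) * y = z * (x * y) ∧ (z * y) * x = z * (y * x) := by
  have h0 : asr x y z = 0 := sub_eq_zero.2 h
  have a : asr x z y = 0 := by rw [asr2 halt, h0, neg_zero]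
  have b : asr y x z = 0 := by rw [asr1 halt, h0, neg_zero]
  have c : asr y z x = 0 := by rw [asr2 halt, b, neg_zero]
  have d : asr z x y = 0 := by rw [asr1 halt, a, neg_zero]
  have f : asr z y x = 0 := by rw [asr1 halt, c, neg_zero]
  exact ⟨sub_eq_zero.1 a, sub_eq_zero.1 b, sub_eq_zero.1 c, sub_eq_zero.1 d, sub_eq_zero.1 f⟩

variable {e : R}

lemma p11_12 (halt : IsAlt R) {a x : R} (ha : a ∈ P11 e) (hx : x ∈ P12 e) : a * x ∈ P12 e ∧ x * a = 0 := by
  obtain ⟨a1, a2⟩ := ha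
  obtain ⟨x1, x2⟩ := hx
  have := asr_all halt (x := a) (y := e) (z := x) (by rw [a2, x1])
  simp only [a1, a2, x1, x2, zero_mul, mul_zero] at this
  obtain ⟨h1, h2, h3, h4, h5⟩ := this
  exact ⟨⟨h2.symm, h1⟩, h5.symm⟩

lemma p22_12 (halt : IsAlt R) {a x : R} (ha : a ∈ P22 e) (hx : x ∈ P12 e) : x * a ∈ P12 e ∧ a * x = 0 := by
  obtain ⟨a1, a2⟩ := ha
  obtain ⟨x1, x2⟩ := hx
  have := asr_all halt (x := x) (y := e) (z := a) (by rw [x2, a1]; simp)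
  simp only [a1, a2, x1, x2, zero_mul, mul_zero] at this
  obtain ⟨h1, h2, h3, h4, h5⟩ := this
  exact ⟨⟨h2.symm, h1⟩, h5.symm⟩

lemma p11_21 (halt : IsAlt R) {a x : R} (ha : a ∈ P11 e) (hx : x ∈ P21 e) : x * a ∈ P21 e ∧ a * x = 0 := by
  obtain ⟨a1, a2⟩ := ha
  obtain ⟨x1, x2⟩ := hx
  have := asr_all halt (x := x) (y := e) (z := a) (by rw [x2, a1])
  simp only [a1, a2, x1, x2, zero_mul, mul_zero] at this
  obtain ⟨h1, h2, h3, h4, h5⟩ := this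
  exact ⟨⟨h2.symm, h1⟩, h5⟩

lemma p22_21 (halt : IsAlt R) {a x : R} (ha : a ∈ P22 e) (hx : x ∈ P21 e) : a * x ∈ P21 e ∧ x * a = 0 := by
  obtain ⟨a1, a2⟩ := ha
  obtain ⟨x1, x2⟩ := hx
  have := asr_all halt (x := a) (y := e) (z := x) (by rw [a2, x1]; simp)
  simp only [a1, a2, x1, x2, zero_mul, mul_zero] at this
  obtain ⟨h1, h2, h3, h4, h5⟩ := this
  exact ⟨⟨h2.symm, h1⟩, h5⟩

lemma p12_21 (halt : IsAlt R) {x y : R} (hx : x ∈ P12 e) (hy : y ∈ P21 e) : br (br x y) e = 0 := by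
  obtain ⟨x1, x2⟩ := hx
  obtain ⟨y1, y2⟩ := hy
  have := asr_all halt (x := x) (y := e) (z := y) (by rw [x2, y1]; simp)
  simp only [y1, y2, x1, x2, zero_mul, mul_zero] at this
  obtain ⟨h1, h2, h3, h4, h5⟩ := this
  simp only [br, sub_mul, mul_sub]
  rw [h1, ← h2, h4, ← h3]; abel

lemma p12_12 (halt : IsAlt R) {x y : R} (hx : x ∈ P12 e) (hy : y ∈ P12 e) : x * y ∈ P21 e := by
  obtain ⟨x1, x2⟩ := hx
  obtain ⟨y1, y2⟩ := hy
  have h1 := asr1 halt x e y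
  have h2 := asr2 halt x e y
  simp only [asr, x1, x2, y1, y2, zero_mul, mul_zero, zero_sub, sub_zero, neg_sub] at h1 h2
  refine ⟨?_, ?_⟩
  · have h3 : e * (x * y) = -(x * y) + x * y := by rw [h1]; abel
    rw [h3, neg_add_cancel]
  · exact (neg_injective h2).symm

lemma P21_sub {x y : R} (hx : x ∈ P21 e) (hy : y ∈ P21 e) : x - y ∈ P21 e :=
  ⟨by rw [mul_sub, hx.1, hy.1, sub_zero], by rw [sub_mul, hx.2, hy.2]⟩

lemma P12_sub {x y : R} (hx : x ∈ P12 e) (hy : y ∈ P12 e) : x - y ∈ P12 e :=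
  ⟨by rw [mul_sub, hx.1, hy.1], by rw [sub_mul, hx.2, hy.2, sub_zero]⟩

lemma P12_add {x y : R} (hx : x ∈ P12 e) (hy : y ∈ P12 e) : x + y ∈ P12 e :=
  ⟨by rw [mul_add, hx.1, hy.1], by rw [add_mul, hx.2, hy.2, add_zero]⟩

lemma P12_neg {x : R} (hx : x ∈ P12 e) : -x ∈ P12 e :=
  ⟨by rw [mul_neg, hx.1], by rw [neg_mul, hx.2, neg_zero]⟩

lemma P21_neg {x : R} (hx : x ∈ P21 e) : -x ∈ P21 e :=
  ⟨by rw [mul_neg, hx.1, neg_zero], by rw [neg_mul, hx.2]⟩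

/-- iterate of bracket with `e` -/
abbrev EE (e : R) (k : ℕ) : R →+ R := HH (fun _ => e) k

lemma EE_succ (k : ℕ) (t : R) : EE e (k+1) t = br (EE e k t) e := rfl

lemma EE_succ2 (k : ℕ) (t : R) : EE e (k+1) t = EE e k (br t e) := by
  induction k with
  | zero => rfl
  | succ k ih => rw [EE_succ, ih, EE_succ]

lemma EE_21 (k : ℕ) {t : R} (ht : t ∈ P21 e) : EE e k t = t := by
  induction k with
  | zero => rfl
  | succ k ih => rw [EE_succ, ih, br, ht.1, ht.2, sub_zero]

lemma EE_12 (k : ℕ) : (∀ t ∈ P12 e, EE e k t = t) ∨ (∀ t ∈ P12 e, EE e k t = -t) := by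
  induction k with
  | zero => left; intro t _; rfl
  | succ k ih =>
    rcases ih with h | h
    · right; intro t ht; rw [EE_succ, h t ht, br, ht.1, ht.2, zero_sub]
    · left; intro t ht
      rw [EE_succ, h t ht, br, neg_mul, mul_neg, ht.1, ht.2, neg_zero, zero_sub, neg_neg]

lemma EE_12_mem (k : ℕ) {t : R} (ht : t ∈ P12 e) : EE e k t ∈ P12 e := by
  rcases EE_12 (e := e) k with h | h <;> rw [h t ht]
  · exact ht
  · exact P12_neg ht

lemma EE_12_inv (k : ℕ) {t : R} (ht : t ∈ P12 e) : EE e k (EE e k t) = t := by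
  rcases EE_12 (e := e) k with h | h <;> rw [h t ht]
  · exact h t ht
  · rw [h _ (P12_neg ht), neg_neg]

lemma EE_zero {k : ℕ} (hk : 1 ≤ k) {t : R} (ht : br t e = 0) : EE e k t = 0 := by
  obtain ⟨k, rfl⟩ := Nat.exists_eq_add_of_le' hk
  rw [EE_succ2, ht, map_zero]

lemma br3 (halt : IsAlt R)
    (he : e * e = e) (t : R) : br (br (br t e) e) e = br t e := by
  have h1 := (halt e t).1
  have h2 := (halt e t).2
  have h3 := (asr_all halt h1).1
  rw [he] at h1 h2
  simp only [br, sub_mul, mul_sub, h2, h3, ← h1]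
  have h4 := (halt e (t*e)).1
  rw [he] at h4
  have h5 := (halt e (e*t)).2
  rw [he, h3] at h5
  rw [← h4, h5]
  abel

lemma EE_inj (halt : IsAlt R)
    (he : e * e = e) (k : ℕ) {t : R} (h : EE e (k+1) t = 0) : br t e = 0 := by
  induction k with
  | zero => exact h
  | succ k ih =>
    apply ih
    rw [EE_succ, EE_succ] at h
    rw [EE_succ]
    have := br3 halt he (EE e k t)
    rw [h] at this
    rw [← this]; simp [br]

lemma split_comm (halt : IsAlt R)
    (he : e * e = e) {T : R} (h : br T e = 0) :
    ∃ p ∈ P11 e, ∃ q ∈ P22 e, T = p + q := by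
  have h0 : T * e = e * T := sub_eq_zero.1 h
  have h1 := (halt e T).1
  have h2 := (halt e T).2
  rw [he] at h1 h2
  refine ⟨e * T, ⟨h1.symm, ?_⟩, T - e * T, ⟨?_, ?_⟩, by abel⟩
  · rw [← h0, h2]
  · rw [mul_sub, ← h1, sub_self]
  · rw [sub_mul, ← h0, h2, sub_self]

section main
lemma cen12 (halt : IsAlt R)
    (he : e * e = e)
    (hcondi : ∀ a ∈ P11 e, ∀ b ∈ P22 e,
      (∀ x ∈ P12 e, (a + b) * x = x * (a + b)) → a + b ∈ rctr R) (k : ℕ) {T : R} (h : EE e k (br T e) = 0)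
    (h2 : ∀ x ∈ P12 e, EE e k (br T x) = 0) : T ∈ rctr R := by
  rw [← EE_succ2] at h
  obtain ⟨p, hp, q, hq, rfl⟩ := split_comm halt he (EE_inj halt he k h)
  refine hcondi p hp q hq fun x hx => ?_
  have h3 := h2 x hx
  obtain ⟨m1, z1⟩ := p11_12 halt hp hx
  obtain ⟨m2, z2⟩ := p22_12 halt hq hx
  have hm : br (p+q) x ∈ P12 e := by
    have : br (p+q) x = p * x - x * q := by rw [br, add_mul, mul_add, z1, z2]; abel
    rw [this]; exact P12_sub m1 m2
  have h4 := EE_12_inv k hm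
  rw [h3, map_zero] at h4
  exact sub_eq_zero.1 h4.symm

lemma cen21 (halt : IsAlt R)
    (he : e * e = e)
    (hcondii : ∀ a ∈ P11 e, ∀ b ∈ P22 e,
      (∀ x ∈ P21 e, (a + b) * x = x * (a + b)) → a + b ∈ rctr R) (k : ℕ) {T : R} (h : EE e k (br T e) = 0)
    (h2 : ∀ x ∈ P21 e, EE e k (br T x) = 0) : T ∈ rctr R := by
  rw [← EE_succ2] at h
  obtain ⟨p, hp, q, hq, rfl⟩ := split_comm halt he (EE_inj halt he k h)
  refine hcondii p hp q hq fun x hx => ?_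
  have h3 := h2 x hx
  obtain ⟨m1, z1⟩ := p11_21 halt hp hx
  obtain ⟨m2, z2⟩ := p22_21 halt hq hx
  have hm : br (p+q) x ∈ P21 e := by
    have : br (p+q) x = q * x - x * p := by rw [br, add_mul, mul_add, z1, z2]; abel
    rw [this]; exact P21_sub m2 m1
  rw [EE_21 k hm] at h3
  exact sub_eq_zero.1 h3

lemma br_add_left (a b c : R) : br (a+b) c = br a c + br b c := by
  simp only [br, add_mul, mul_add]; abel
lemma br_sub_left (a b c : R) : br (a-b) c = br a c - br b c := by
  simp only [br, sub_mul, mul_sub]; abel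
lemma br_add_right (a b c : R) : br a (b+c) = br a b + br a c := by
  simp only [br, add_mul, mul_add]; abel
lemma br_cen {z : R} (hz : z ∈ rctr R) (x : R) : br z x = 0 := sub_eq_zero.2 (hz x)
lemma br_cen_right {z : R} (hz : z ∈ rctr R) (x : R) : br x z = 0 := sub_eq_zero.2 (hz x).symm

variable {k : ℕ} {D : R → R} {F : R →+ R}

lemma D_zero (hF : ∀ u v, D (EE e k (br u v)) =
      EE e k (br (D u) v) + EE e k (br u (D v)) + F (br u v)) : D 0 = 0 := by
  have h := hF 0 0
  simpa [br] using h

lemma sub_zero' (hF : ∀ u v, D (EE e k (br u v)) =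
      EE e k (br (D u) v) + EE e k (br u (D v)) + F (br u v)) {a b v : R}
    (h : D (EE e k (br (a+b) v)) = D (EE e k (br a v)) + D (EE e k (br b v))) :
    EE e k (br (D (a+b) - (D a + D b)) v) = 0 := by
  rw [hF, hF, hF] at h
  simp only [br_add_left, br_sub_left, map_add, map_sub] at h ⊢
  rw [← sub_eq_zero] at h
  rw [← h]; abel

lemma mul4 (hF : ∀ u v, D (EE e k (br u v)) =
      EE e k (br (D u) v) + EE e k (br u (D v)) + F (br u v)) {a b c d : R} (h1 : D (a+b) - (D a + D b) ∈ rctr R)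
    (h2 : D (c+d) - (D c + D d) ∈ rctr R) :
    D (EE e k (br (a+b) (c+d))) = D (EE e k (br a c)) + D (EE e k (br a d))
      + D (EE e k (br b c)) + D (EE e k (br b d)) := by
  have e1 : br (D (a+b)) (c+d) = br (D a) (c+d) + br (D b) (c+d) := by
    have := br_cen h1 (c+d)
    rw [br_sub_left, br_add_left, sub_eq_zero] at this
    exact this
  have e2 : br (a+b) (D (c+d)) = br (a+b) (D c) + br (a+b) (D d) := by
    have := br_cen_right h2 (a+b)
    rw [← br_add_right]
    have h3 : D (c+d) = (D c + D d) + (D (c+d) - (D c + D d)) := by abel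
    rw [h3, br_add_right, this, add_zero]
  simp only [hF]
  rw [e1, e2]
  simp only [br_add_left, br_add_right, map_add]
  abel

lemma br_11 {a : R} (ha : a ∈ P11 e) : br a e = 0 := by rw [br, ha.1, ha.2, sub_self]
lemma br_22 {a : R} (ha : a ∈ P22 e) : br a e = 0 := by rw [br, ha.1, ha.2, sub_self]

lemma A1 (halt : IsAlt R)
    (he : e * e = e)
    (hcondii : ∀ a ∈ P11 e, ∀ b ∈ P22 e,
      (∀ x ∈ P21 e, (a + b) * x = x * (a + b)) → a + b ∈ rctr R)
    (hk : 1 ≤ k)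
    (hF : ∀ u v, D (EE e k (br u v)) =
      EE e k (br (D u) v) + EE e k (br u (D v)) + F (br u v)) {a b : R} (ha : a ∈ P11 e) (hb : b ∈ P12 e) : D (a+b) - (D a + D b) ∈ rctr R := by
  have h0 := D_zero hF
  refine cen21 halt he hcondii k (sub_zero' hF ?_) fun y hy => sub_zero' hF ?_
  · rw [br_add_left, br_11 ha, map_zero, h0, zero_add, zero_add]
  · rw [br_add_left, map_add, EE_zero hk (p12_21 halt hb hy), h0, add_zero, add_zero]

lemma A2 (halt : IsAlt R)
    (he : e * e = e)
    (hcondi : ∀ a ∈ P11 e, ∀ b ∈ P22 e,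
      (∀ x ∈ P12 e, (a + b) * x = x * (a + b)) → a + b ∈ rctr R)
    (hk : 1 ≤ k)
    (hF : ∀ u v, D (EE e k (br u v)) =
      EE e k (br (D u) v) + EE e k (br u (D v)) + F (br u v)) {a b : R} (ha : a ∈ P11 e) (hb : b ∈ P21 e) : D (a+b) - (D a + D b) ∈ rctr R := by
  have h0 := D_zero hF
  refine cen12 halt he hcondi k (sub_zero' hF ?_) fun y hy => sub_zero' hF ?_
  · rw [br_add_left, br_11 ha, map_zero, h0, zero_add, zero_add]
  · have : br (br b y) e = 0 := by
      have h := p12_21 halt hy hb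
      have h' : br b y = - br y b := by simp [br]
      rw [h', br, neg_mul, mul_neg, ← neg_sub', ← br, h, neg_zero]
    rw [br_add_left, map_add, EE_zero hk this, h0, add_zero, add_zero]

lemma BB (halt : IsAlt R)
    (he : e * e = e)
    (hcondi : ∀ a ∈ P11 e, ∀ b ∈ P22 e,
      (∀ x ∈ P12 e, (a + b) * x = x * (a + b)) → a + b ∈ rctr R)
    (hcondii : ∀ a ∈ P11 e, ∀ b ∈ P22 e,
      (∀ x ∈ P21 e, (a + b) * x = x * (a + b)) → a + b ∈ rctr R)
    (hk : 1 ≤ k)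
    (hF : ∀ u v, D (EE e k (br u v)) =
      EE e k (br (D u) v) + EE e k (br u (D v)) + F (br u v)) {a b : R} (ha : a ∈ P12 e) (hb : b ∈ P21 e) : D (a+b) = D a + D b := by
  have h0 := D_zero hF
  have he1 : e ∈ P11 e := ⟨he, he⟩
  have he2 : -e ∈ P11 e := ⟨by rw [mul_neg, he], by rw [neg_mul, he]⟩
  have ha' := EE_12_mem k ha
  have hb' := P21_neg hb
  have h := mul4 hF (A1 halt he hcondii hk hF he1 ha') (A2 halt he hcondi hk hF he2 hb')
  have c1 : br e (-e) = 0 := by simp [br]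
  have c2 : br e (-b) = b := by rw [br, hb'.1, hb'.2]; simp
  have c3 : br (EE e k a) (-e) = EE e k a := by
    rw [br, mul_neg, neg_mul, ha'.1, ha'.2]; simp
  have c4 := EE_zero hk (p12_21 halt ha' hb')
  rw [br_add_left, br_add_right, br_add_right, c1, c2, c3, map_add, map_add, map_add, c4,
    EE_12_inv k ha, EE_21 k hb, map_zero, h0] at h
  simpa [add_comm] using h

lemma CC (halt : IsAlt R)
    (he : e * e = e)
    (hcondi : ∀ a ∈ P11 e, ∀ b ∈ P22 e,
      (∀ x ∈ P12 e, (a + b) * x = x * (a + b)) → a + b ∈ rctr R)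
    (hcondii : ∀ a ∈ P11 e, ∀ b ∈ P22 e,
      (∀ x ∈ P21 e, (a + b) * x = x * (a + b)) → a + b ∈ rctr R)
    (hk : 1 ≤ k)
    (hF : ∀ u v, D (EE e k (br u v)) =
      EE e k (br (D u) v) + EE e k (br u (D v)) + F (br u v)) {x y : R} (hx : x ∈ P12 e) (hy : y ∈ P12 e) : D (x+y) = D x + D y := by
  have h0 := D_zero hF
  have he1 : e ∈ P11 e := ⟨he, he⟩
  have he2 : -e ∈ P11 e := ⟨by rw [mul_neg, he], by rw [neg_mul, he]⟩
  have hx' := EE_12_mem k hx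
  have hy' := EE_12_mem k hy
  have h := mul4 hF (A1 halt he hcondii hk hF he1 hx') (A1 halt he hcondii hk hF he2 hy')
  have c1 : br e (-e) = 0 := by simp [br]
  have c2 : br e (EE e k y) = EE e k y := by rw [br, hy'.1, hy'.2]; simp
  have c3 : br (EE e k x) (-e) = EE e k x := by
    rw [br, mul_neg, neg_mul, hx'.1, hx'.2]; simp
  have c4 : br (EE e k x) (EE e k y) ∈ P21 e :=
    P21_sub (p12_12 halt hx' hy') (p12_12 halt hy' hx')
  rw [br_add_left, br_add_right, br_add_right, c1, c2, c3, map_add, map_add, map_add,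
    EE_12_inv k hx, EE_12_inv k hy, EE_21 k c4, map_zero, h0, zero_add, zero_add, ← add_assoc,
    BB halt he hcondi hcondii hk hF (P12_add hy hx) c4] at h
  rw [add_comm x y, add_right_cancel h, add_comm]

lemma fin_aux (halt : IsAlt R)
    (he : e * e = e)
    (hcondi : ∀ a ∈ P11 e, ∀ b ∈ P22 e,
      (∀ x ∈ P12 e, (a + b) * x = x * (a + b)) → a + b ∈ rctr R)
    (hcondii : ∀ a ∈ P11 e, ∀ b ∈ P22 e,
      (∀ x ∈ P21 e, (a + b) * x = x * (a + b)) → a + b ∈ rctr R)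
    (hk : 1 ≤ k)
    (hF : ∀ u v, D (EE e k (br u v)) =
      EE e k (br (D u) v) + EE e k (br u (D v)) + F (br u v)) {a b : R} (ha : br a e = 0) (hb : br b e = 0)
    (ha2 : ∀ x ∈ P12 e, br a x ∈ P12 e) (hb2 : ∀ x ∈ P12 e, br b x ∈ P12 e) :
    ∃ z ∈ rctr R, D (a + b) = D a + D b + z := by
  have h0 := D_zero hF
  refine ⟨D (a+b) - (D a + D b), ?_, by abel⟩
  refine cen12 halt he hcondi k (sub_zero' hF ?_) fun x hx => sub_zero' hF ?_
  · rw [br_add_left, ha, hb, add_zero, map_zero, h0, add_zero]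
  · rw [br_add_left, map_add]
    exact CC halt he hcondi hcondii hk hF (EE_12_mem k (ha2 x hx)) (EE_12_mem k (hb2 x hx))

end main

lemma br11_mem (halt : IsAlt R) {a x : R} (ha : a ∈ P11 e) (hx : x ∈ P12 e) : br a x ∈ P12 e := by
  obtain ⟨m, z⟩ := p11_12 halt ha hx
  rw [br, z, sub_zero]; exact m

lemma br22_mem (halt : IsAlt R) {a x : R} (ha : a ∈ P22 e) (hx : x ∈ P12 e) : br a x ∈ P12 e := by
  obtain ⟨m, z⟩ := p22_12 halt ha hx
  rw [br, z, zero_sub]; exact P12_neg m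

end aux

theorem stmt4 {R : Type*} [NonUnitalNonAssocRing R] (halt : IsAlt R)
    (e₁ : R) (he : e₁ * e₁ = e₁) (hne : e₁ ≠ 0)
    (hnu : ¬ ∀ x : R, e₁ * x = x ∧ x * e₁ = x)
    (hcondi : ∀ a ∈ P11 e₁, ∀ b ∈ P22 e₁,
      (∀ x ∈ P12 e₁, (a + b) * x = x * (a + b)) → a + b ∈ rctr R)
    (hcondii : ∀ a ∈ P11 e₁, ∀ b ∈ P22 e₁,
      (∀ x ∈ P21 e₁, (a + b) * x = x * (a + b)) → a + b ∈ rctr R)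
    (n : ℕ) (hn : 2 ≤ n) (D : R → R) (hD : IsMultLieNDeriv n D) :
    (∀ a ∈ P11 e₁, ∀ b ∈ P11 e₁, ∃ z ∈ rctr R, D (a + b) = D a + D b + z) ∧
    (∀ a ∈ P22 e₁, ∀ b ∈ P22 e₁, ∃ z ∈ rctr R, D (a + b) = D a + D b + z) := by
  obtain ⟨k, hk, F, hF⟩ := key n hn D hD e₁
  exact ⟨fun a ha b hb => fin_aux halt he hcondi hcondii hk hF (br_11 ha) (br_11 hb)
      (fun x hx => br11_mem halt ha hx) (fun x hx => br11_mem halt hb hx),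
    fun a ha b hb => fin_aux halt he hcondi hcondii hk hF (br_22 ha) (br_22 hb)
      (fun x hx => br22_mem halt ha hx) (fun x hx => br22_mem halt hb hx)⟩
end

section
/- Let R be a 3-torsion free prime alternative ring containing a nontrivial idempotent e₁. Then every map D : R → R (not assumed additive) satisfying D([[x,y],z]) = [[D(x),y],z] + [[x,D(y)],z] + [[x,y],D(z)] for all x, y, z ∈ R is almost additive: for all a, b ∈ R there exists w ∈ Z(R) such that D(a + b) = D(a) + D(b) + w. -/
/-- A two-sided ideal of a possibly non-associative, non-unital ring, as a set. -/
def IsIdealSet {R : Type*} [NonUnitalNonAssocRing R] (I : Set R) : Prop :=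
  (0 : R) ∈ I ∧ (∀ a ∈ I, ∀ b ∈ I, a + b ∈ I) ∧ (∀ a ∈ I, -a ∈ I) ∧
    ∀ r : R, ∀ a ∈ I, r * a ∈ I ∧ a * r ∈ I

/-- `R` is a prime ring: any two nonzero ideals have a nonzero product of elements. -/
def IsPrimeRing (R : Type*) [NonUnitalNonAssocRing R] : Prop :=
  ∀ A B : Set R, IsIdealSet A → IsIdealSet B → A ≠ {0} → B ≠ {0} →
    ∃ a ∈ A, ∃ b ∈ B, a * b ≠ 0

namespace LieAlt

section ids
variable {R : Type*} [NonUnitalNonAssocRing R]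

lemma sw1 (h : IsAlt R) (a b c : R) :
    (a * b) * c - a * (b * c) + ((b * a) * c - b * (a * c)) = 0 := by
  have h1 := (h (a + b) c).1
  have h2 := (h a c).1
  have h3 := (h b c).1
  simp only [add_mul, mul_add] at h1
  rw [h2, h3] at h1
  rw [← sub_eq_zero] at h1
  rw [← h1]; abel

lemma sw2 (h : IsAlt R) (a b c : R) :
    (a * b) * c - a * (b * c) + ((a * c) * b - a * (c * b)) = 0 := by
  have h1 := (h (b + c) a).2
  have h2 := (h b a).2
  have h3 := (h c a).2
  simp only [add_mul, mul_add] at h1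
  rw [h2, h3] at h1
  rw [← sub_eq_zero] at h1
  rw [← h1]; abel

lemma cyc (h : IsAlt R) (a b c : R) :
    (a * b) * c - a * (b * c) = (b * c) * a - b * (c * a) := by
  have h1 := sw1 h a b c
  have h2 := sw2 h b a c
  rw [← sub_eq_zero, ← h1, ← sub_eq_zero, ← neg_eq_zero, ← h2]
  abel

/-- Peirce-type decomposition data. -/
structure Pe (p11 p12 p21 p22 : AddSubgroup R) : Prop where
  alt : IsAlt R
  prime : IsPrimeRing R
  dec : ∀ r : R, ∃ a ∈ p11, ∃ b ∈ p12, ∃ c ∈ p21, ∃ d ∈ p22, r = a + b + c + d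
  c1111 : ∀ x ∈ p11, ∀ y ∈ p11, x * y ∈ p11
  c1112 : ∀ x ∈ p11, ∀ y ∈ p12, x * y ∈ p12
  c1121 : ∀ x ∈ p11, ∀ y ∈ p21, x * y = 0
  c1122 : ∀ x ∈ p11, ∀ y ∈ p22, x * y = 0
  c1211 : ∀ x ∈ p12, ∀ y ∈ p11, x * y = 0
  c1212 : ∀ x ∈ p12, ∀ y ∈ p12, x * y ∈ p21
  c1221 : ∀ x ∈ p12, ∀ y ∈ p21, x * y ∈ p11
  c1222 : ∀ x ∈ p12, ∀ y ∈ p22, x * y ∈ p12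
  c2111 : ∀ x ∈ p21, ∀ y ∈ p11, x * y ∈ p21
  c2112 : ∀ x ∈ p21, ∀ y ∈ p12, x * y ∈ p22
  c2121 : ∀ x ∈ p21, ∀ y ∈ p21, x * y ∈ p12
  c2122 : ∀ x ∈ p21, ∀ y ∈ p22, x * y = 0
  c2211 : ∀ x ∈ p22, ∀ y ∈ p11, x * y = 0
  c2212 : ∀ x ∈ p22, ∀ y ∈ p12, x * y = 0
  c2221 : ∀ x ∈ p22, ∀ y ∈ p21, x * y ∈ p21
  c2222 : ∀ x ∈ p22, ∀ y ∈ p22, x * y ∈ p22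

lemma Pe.swap {p11 p12 p21 p22 : AddSubgroup R} (h : Pe p11 p12 p21 p22) :
    Pe p22 p21 p12 p11 where
  alt := h.alt
  prime := h.prime
  dec := by
    intro r
    obtain ⟨a, ha, b, hb, c, hc, d, hd, rfl⟩ := h.dec r
    exact ⟨d, hd, c, hc, b, hb, a, ha, by abel⟩
  c1111 := h.c2222
  c1112 := h.c2221
  c1121 := h.c2212
  c1122 := h.c2211
  c1211 := h.c2122
  c1212 := h.c2121
  c1221 := h.c2112
  c1222 := h.c2111
  c2111 := h.c1222
  c2112 := h.c1221
  c2121 := h.c1212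
  c2122 := h.c1211
  c2211 := h.c1122
  c2212 := h.c1121
  c2221 := h.c1112
  c2222 := h.c1111

/-- The opposite multiplication on the same additive group. -/
@[reducible] def opR (R : Type*) [i : NonUnitalNonAssocRing R] : NonUnitalNonAssocRing R :=
  { i with
    mul := fun a b => i.mul b a
    left_distrib := fun a b c => i.right_distrib b c a
    right_distrib := fun a b c => i.left_distrib c a b
    zero_mul := fun a => i.mul_zero a
    mul_zero := fun a => i.zero_mul a }

lemma Pe.op {p11 p12 p21 p22 : AddSubgroup R} (h : Pe p11 p12 p21 p22) :
    @Pe R (opR R) p11 p21 p12 p22 := by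
  refine @Pe.mk R (opR R) p11 p21 p12 p22 ?_ ?_ ?_ ?_ ?_ ?_ ?_ ?_ ?_ ?_ ?_ ?_ ?_ ?_ ?_ ?_ ?_ ?_ ?_
  · intro x y
    exact ⟨(h.alt x y).2.symm, (h.alt x y).1.symm⟩
  · intro A B hA hB hA0 hB0
    obtain ⟨b, hb, a, ha, hab⟩ := h.prime B A
      ⟨hB.1, hB.2.1, hB.2.2.1, fun r a ha => (hB.2.2.2 r a ha).symm⟩
      ⟨hA.1, hA.2.1, hA.2.2.1, fun r a ha => (hA.2.2.2 r a ha).symm⟩ hB0 hA0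
    exact ⟨a, ha, b, hb, hab⟩
  · intro r
    obtain ⟨a, ha, b, hb, c, hc, d, hd, rfl⟩ := h.dec r
    refine ⟨a, ha, c, hc, b, hb, d, hd, ?_⟩
    change a + b + c + d = a + c + b + d
    abel
  · exact fun x hx y hy => h.c1111 y hy x hx
  · exact fun x hx y hy => h.c2111 y hy x hx
  · exact fun x hx y hy => h.c1211 y hy x hx
  · exact fun x hx y hy => h.c2211 y hy x hx
  · exact fun x hx y hy => h.c1121 y hy x hx
  · exact fun x hx y hy => h.c2121 y hy x hx
  · exact fun x hx y hy => h.c1221 y hy x hx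
  · exact fun x hx y hy => h.c2221 y hy x hx
  · exact fun x hx y hy => h.c1112 y hy x hx
  · exact fun x hx y hy => h.c2112 y hy x hx
  · exact fun x hx y hy => h.c1212 y hy x hx
  · exact fun x hx y hy => h.c2212 y hy x hx
  · exact fun x hx y hy => h.c1122 y hy x hx
  · exact fun x hx y hy => h.c2122 y hy x hx
  · exact fun x hx y hy => h.c1222 y hy x hx
  · exact fun x hx y hy => h.c2222 y hy x hx

/-- The right annihilator of a nonzero ideal in a prime alternative ring is zero. -/
lemma ann (h : IsAlt R) (hp : IsPrimeRing R) (I : Set R) (hI : IsIdealSet I)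
    (s : R) (hs : s ∈ I) (hs0 : s ≠ 0) (j : R) (hj : ∀ i ∈ I, i * j = 0) : j = 0 := by
  by_contra hj0
  have hJ : IsIdealSet {j : R | ∀ i ∈ I, i * j = 0} := by
    refine ⟨fun i _ => mul_zero i, ?_, ?_, ?_⟩
    · intro a ha b hb i hi
      rw [mul_add, ha i hi, hb i hi, add_zero]
    · intro a ha i hi
      rw [mul_neg, ha i hi, neg_zero]
    · intro r a ha
      have key : ∀ i ∈ I, i * (r * a) = 0 := by
        intro i hi
        have h1 := sw1 h i r a
        rw [ha i hi, ha _ (hI.2.2.2 r i hi).1, ha _ (hI.2.2.2 r i hi).2, mul_zero] at h1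
        simpa using h1
      refine ⟨key, ?_⟩
      intro i hi
      have h1 := sw2 h i r a
      rw [ha i hi, ha _ (hI.2.2.2 r i hi).2, key i hi] at h1
      simpa using h1
  obtain ⟨a, ha, b, hb, hab⟩ := hp I _ hI hJ (by
    intro h0; rw [h0] at hs; exact hs0 hs) (by
    intro h0
    have : j ∈ {j : R | ∀ i ∈ I, i * j = 0} := hj
    rw [h0] at this; exact hj0 this)
  exact hab (hb a ha)

namespace Pe
variable {p11 p12 p21 p22 : AddSubgroup R}

lemma as111112 (h : Pe p11 p12 p21 p22) {a b x : R} (ha : a ∈ p11) (hb : b ∈ p11) (hx : x ∈ p12) :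
    (a * b) * x = a * (b * x) := by
  have := sw2 h.alt a b x
  rw [h.c1211 _ (h.c1112 _ ha _ hx) _ hb, h.c1211 _ hx _ hb] at this
  simpa [sub_eq_zero] using this

lemma as111222 (h : Pe p11 p12 p21 p22) {a x w : R} (ha : a ∈ p11) (hx : x ∈ p12) (hw : w ∈ p22) :
    (a * x) * w = a * (x * w) := by
  have := sw2 h.alt a x w
  rw [h.c1122 _ ha _ hw, h.c2212 _ hw _ hx] at this
  simpa [sub_eq_zero] using this

lemma as111221 (h : Pe p11 p12 p21 p22) {a x y : R} (ha : a ∈ p11) (hx : x ∈ p12) (hy : y ∈ p21) :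
    (a * x) * y = a * (x * y) := by
  have := sw2 h.alt a x y
  rw [h.c1121 _ ha _ hy, h.c1122 _ ha _ (h.c2112 _ hy _ hx)] at this
  simpa [sub_eq_zero] using this

lemma as122111 (h : Pe p11 p12 p21 p22) {a x y : R} (ha : a ∈ p11) (hx : x ∈ p12) (hy : y ∈ p21) :
    (x * y) * a = x * (y * a) := by
  have := cyc h.alt a x y
  rw [h.as111221 ha hx hy, sub_self] at this
  exact sub_eq_zero.1 this.symm

lemma as211112 (h : Pe p11 p12 p21 p22) {a x y : R} (ha : a ∈ p11) (hx : x ∈ p12) (hy : y ∈ p21) :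
    (y * a) * x = y * (a * x) := by
  have := cyc h.alt y a x
  rw [h.as111221 ha hx hy, sub_self] at this
  exact sub_eq_zero.1 this

lemma as211111 (h : Pe p11 p12 p21 p22) {a b y : R} (ha : a ∈ p11) (hb : b ∈ p11) (hy : y ∈ p21) :
    (y * a) * b = y * (a * b) := by
  have := cyc h.alt y a b
  rw [h.c1121 _ (h.c1111 _ ha _ hb) _ hy, h.c1121 _ hb _ hy] at this
  simpa [sub_eq_zero] using this

lemma q1 (h : Pe p11 p12 p21 p22) {a y z : R} (ha : a ∈ p11) (hy : y ∈ p21) (hz : z ∈ p21) :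
    (y * a) * z = a * (y * z) := by
  have := sw1 h.alt y a z
  rw [h.c1121 _ ha _ hz, h.c1121 _ ha _ hy] at this
  simp only [mul_zero, zero_mul, sub_zero, zero_sub] at this
  rwa [← sub_eq_add_neg, sub_eq_zero] at this

lemma q2 (h : Pe p11 p12 p21 p22) {w y z : R} (hw : w ∈ p22) (hy : y ∈ p21) (hz : z ∈ p21) :
    (w * y) * z = (y * z) * w := by
  have := cyc h.alt w y z
  rw [h.c2212 _ hw _ (h.c2121 _ hy _ hz), h.c2122 _ hz _ hw] at this
  simpa using this

lemma q3 (h : Pe p11 p12 p21 p22) {a y z : R} (ha : a ∈ p11) (hy : y ∈ p21) (hz : z ∈ p21) :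
    z * (y * a) = - (a * (y * z)) := by
  have := cyc h.alt z y a
  rw [h.c1211 _ (h.c2121 _ hz _ hy) _ ha, h.c1121 _ ha _ hz, h.q1 ha hy hz] at this
  simp only [mul_zero, sub_zero, zero_sub] at this
  rw [← this, neg_neg]

lemma q4 (h : Pe p11 p12 p21 p22) {w y z : R} (hw : w ∈ p22) (hy : y ∈ p21) (hz : z ∈ p21) :
    z * (w * y) = - ((y * z) * w) := by
  have := cyc h.alt z w y
  rw [h.c2122 _ hz _ hw, h.q2 hw hy hz, h.c2212 _ hw _ (h.c2121 _ hy _ hz)] at this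
  simp only [zero_mul, sub_zero, zero_sub] at this
  rw [← this, neg_neg]

/-- An element of `p11` annihilating `p12` from the left is zero. -/
lemma A11 (h : Pe p11 p12 p21 p22) (n12 : ∃ x ∈ p12, x ≠ 0) {s : R} (hs : s ∈ p11)
    (hs0 : ∀ x ∈ p12, s * x = 0) : s = 0 := by
  by_contra hne
  let A : AddSubgroup R :=
    { carrier := {s | s ∈ p11 ∧ ∀ x ∈ p12, s * x = 0}
      zero_mem' := ⟨p11.zero_mem, fun x _ => zero_mul x⟩
      add_mem' := fun {a b} ha hb => ⟨p11.add_mem ha.1 hb.1, fun x hx => by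
        rw [add_mul, ha.2 x hx, hb.2 x hx, add_zero]⟩
      neg_mem' := fun {a} ha => ⟨p11.neg_mem ha.1, fun x hx => by
        rw [neg_mul, ha.2 x hx, neg_zero]⟩ }
  have hA : ∀ s, s ∈ A ↔ s ∈ p11 ∧ ∀ x ∈ p12, s * x = 0 := fun s => Iff.rfl
  let B : AddSubgroup R :=
    { carrier := {b | b ∈ p21 ∧ (∀ x ∈ p12, b * x = 0 ∧ x * b ∈ A) ∧
        (∀ z ∈ p21, b * z = 0 ∧ z * b = 0)}
      zero_mem' := ⟨p21.zero_mem, fun x _ => ⟨zero_mul x, by rw [mul_zero]; exact A.zero_mem⟩,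
        fun x _ => ⟨zero_mul x, mul_zero x⟩⟩
      add_mem' := fun {a b} ha hb => ⟨p21.add_mem ha.1 hb.1, fun x hx =>
        ⟨by rw [add_mul, (ha.2.1 x hx).1, (hb.2.1 x hx).1, add_zero],
         by rw [mul_add]; exact A.add_mem (ha.2.1 x hx).2 (hb.2.1 x hx).2⟩,
        fun x hx =>
        ⟨by rw [add_mul, (ha.2.2 x hx).1, (hb.2.2 x hx).1, add_zero],
         by rw [mul_add, (ha.2.2 x hx).2, (hb.2.2 x hx).2, add_zero]⟩⟩
      neg_mem' := fun {a} ha => ⟨p21.neg_mem ha.1, fun x hx =>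
        ⟨by rw [neg_mul, (ha.2.1 x hx).1, neg_zero],
         by rw [mul_neg]; exact A.neg_mem (ha.2.1 x hx).2⟩,
        fun x hx =>
        ⟨by rw [neg_mul, (ha.2.2 x hx).1, neg_zero],
         by rw [mul_neg, (ha.2.2 x hx).2, neg_zero]⟩⟩ }
  have hB : ∀ b, b ∈ B ↔ b ∈ p21 ∧ (∀ x ∈ p12, b * x = 0 ∧ x * b ∈ A) ∧
        (∀ z ∈ p21, b * z = 0 ∧ z * b = 0) := fun s => Iff.rfl
  have rA : ∀ r ∈ p11, ∀ s ∈ A, r * s ∈ A := by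
    intro r hr s hs
    refine ⟨h.c1111 _ hr _ hs.1, fun x hx => ?_⟩
    rw [h.as111112 hr hs.1 hx, hs.2 x hx, mul_zero]
  have Ar : ∀ r ∈ p11, ∀ s ∈ A, s * r ∈ A := by
    intro r hr s hs
    refine ⟨h.c1111 _ hs.1 _ hr, fun x hx => ?_⟩
    rw [h.as111112 hs.1 hr hx, hs.2 _ (h.c1112 _ hr _ hx)]
  have yA : ∀ y ∈ p21, ∀ s ∈ A, y * s ∈ B := by
    intro y hy s hs
    refine ⟨h.c2111 _ hy _ hs.1, fun x hx => ⟨?_, ?_⟩, fun z hz => ⟨?_, ?_⟩⟩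
    · rw [h.as211112 hs.1 hx hy, hs.2 x hx, mul_zero]
    · rw [← h.as122111 hs.1 hx hy]
      exact rA _ (h.c1221 _ hx _ hy) _ hs
    · rw [h.q1 hs.1 hy hz, hs.2 _ (h.c2121 _ hy _ hz)]
    · rw [h.q3 hs.1 hy hz, hs.2 _ (h.c2121 _ hy _ hz), neg_zero]
  have Br : ∀ r ∈ p11, ∀ b ∈ B, b * r ∈ B := by
    intro r hr b hb
    refine ⟨h.c2111 _ hb.1 _ hr, fun x hx => ⟨?_, ?_⟩, fun z hz => ⟨?_, ?_⟩⟩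
    · rw [h.as211112 hr hx hb.1, (hb.2.1 _ (h.c1112 _ hr _ hx)).1]
    · rw [← h.as122111 hr hx hb.1]
      exact Ar _ hr _ (hb.2.1 x hx).2
    · rw [h.q1 hr hb.1 hz, (hb.2.2 _ hz).1, mul_zero]
    · rw [h.q3 hr hb.1 hz, (hb.2.2 _ hz).1, mul_zero, neg_zero]
  have wB : ∀ w ∈ p22, ∀ b ∈ B, w * b ∈ B := by
    intro w hw b hb
    refine ⟨h.c2221 _ hw _ hb.1, fun x hx => ⟨?_, ?_⟩, fun z hz => ⟨?_, ?_⟩⟩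
    · rw [h.swap.as111221 hw hb.1 hx, (hb.2.1 x hx).1, mul_zero]
    · rw [← h.swap.as211112 hw hb.1 hx]
      exact (hb.2.1 _ (h.c1222 _ hx _ hw)).2
    · rw [h.q2 hw hb.1 hz, (hb.2.2 _ hz).1, zero_mul]
    · rw [h.q4 hw hb.1 hz, (hb.2.2 _ hz).1, zero_mul, neg_zero]
  have hI : IsIdealSet (((A ⊔ B : AddSubgroup R)) : Set R) := by
    refine ⟨(A ⊔ B).zero_mem, fun a ha b hb => (A ⊔ B).add_mem ha hb,
      fun a ha => (A ⊔ B).neg_mem ha, ?_⟩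
    intro r i hi
    obtain ⟨s, hs, b, hb, rfl⟩ := AddSubgroup.mem_sup.1 hi
    obtain ⟨a, ha, x, hx, y, hy, w, hw, rfl⟩ := h.dec r
    constructor
    · refine AddSubgroup.mem_sup.2 ⟨a * s + x * b, A.add_mem (rA _ ha _ hs) (hb.2.1 x hx).2,
        y * s + w * b, B.add_mem (yA _ hy _ hs) (wB _ hw _ hb), ?_⟩
      simp only [add_mul, mul_add]
      rw [h.c1121 _ ha _ hb.1, h.c1211 _ hx _ hs.1, (hb.2.2 y hy).2, h.c2211 _ hw _ hs.1]
      abel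
    · refine AddSubgroup.mem_sup.2 ⟨s * a, Ar _ ha _ hs, b * a, Br _ ha _ hb, ?_⟩
      simp only [add_mul, mul_add]
      rw [hs.2 x hx, h.c1121 _ hs.1 _ hy, h.c1122 _ hs.1 _ hw, (hb.2.1 x hx).1, (hb.2.2 y hy).1,
        h.c2122 _ hb.1 _ hw]
      abel
  obtain ⟨x, hx, hx0⟩ := n12
  refine hx0 (ann h.alt h.prime _ hI s (AddSubgroup.mem_sup_left (⟨hs, hs0⟩ : s ∈ A)) hne x ?_)
  intro i hi
  obtain ⟨s, hs, b, hb, rfl⟩ := AddSubgroup.mem_sup.1 hi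
  rw [add_mul, hs.2 x hx, (hb.2.1 x hx).1, add_zero]

lemma A22 (h : Pe p11 p12 p21 p22) (n12 : ∃ x ∈ p12, x ≠ 0) {s : R} (hs : s ∈ p22)
    (hs0 : ∀ x ∈ p12, x * s = 0) : s = 0 :=
  @A11 R (opR R) p22 p12 p21 p11 h.swap.op n12 s hs hs0

/-- An element of `p21` annihilated by all off-diagonal elements is zero. -/
lemma T21 (h : Pe p11 p12 p21 p22) {t : R} (ht : t ∈ p21)
    (h1 : ∀ x ∈ p12, t * x = 0 ∧ x * t = 0) (h2 : ∀ z ∈ p21, t * z = 0 ∧ z * t = 0) : t = 0 := by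
  by_contra hne
  let B : AddSubgroup R :=
    { carrier := {b | b ∈ p21 ∧ (∀ x ∈ p12, b * x = 0 ∧ x * b = 0) ∧
        (∀ z ∈ p21, b * z = 0 ∧ z * b = 0)}
      zero_mem' := ⟨p21.zero_mem, fun x _ => ⟨zero_mul x, mul_zero x⟩,
        fun x _ => ⟨zero_mul x, mul_zero x⟩⟩
      add_mem' := fun {a b} ha hb => ⟨p21.add_mem ha.1 hb.1, fun x hx =>
        ⟨by rw [add_mul, (ha.2.1 x hx).1, (hb.2.1 x hx).1, add_zero],
         by rw [mul_add, (ha.2.1 x hx).2, (hb.2.1 x hx).2, add_zero]⟩,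
        fun x hx =>
        ⟨by rw [add_mul, (ha.2.2 x hx).1, (hb.2.2 x hx).1, add_zero],
         by rw [mul_add, (ha.2.2 x hx).2, (hb.2.2 x hx).2, add_zero]⟩⟩
      neg_mem' := fun {a} ha => ⟨p21.neg_mem ha.1, fun x hx =>
        ⟨by rw [neg_mul, (ha.2.1 x hx).1, neg_zero],
         by rw [mul_neg, (ha.2.1 x hx).2, neg_zero]⟩,
        fun x hx =>
        ⟨by rw [neg_mul, (ha.2.2 x hx).1, neg_zero],
         by rw [mul_neg, (ha.2.2 x hx).2, neg_zero]⟩⟩ }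
  have Br : ∀ r ∈ p11, ∀ b ∈ B, b * r ∈ B := by
    intro r hr b hb
    refine ⟨h.c2111 _ hb.1 _ hr, fun x hx => ⟨?_, ?_⟩, fun z hz => ⟨?_, ?_⟩⟩
    · rw [h.as211112 hr hx hb.1, (hb.2.1 _ (h.c1112 _ hr _ hx)).1]
    · rw [← h.as122111 hr hx hb.1, (hb.2.1 x hx).2, zero_mul]
    · rw [h.q1 hr hb.1 hz, (hb.2.2 _ hz).1, mul_zero]
    · rw [h.q3 hr hb.1 hz, (hb.2.2 _ hz).1, mul_zero, neg_zero]
  have wB : ∀ w ∈ p22, ∀ b ∈ B, w * b ∈ B := by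
    intro w hw b hb
    refine ⟨h.c2221 _ hw _ hb.1, fun x hx => ⟨?_, ?_⟩, fun z hz => ⟨?_, ?_⟩⟩
    · rw [h.swap.as111221 hw hb.1 hx, (hb.2.1 x hx).1, mul_zero]
    · rw [← h.swap.as211112 hw hb.1 hx, (hb.2.1 _ (h.c1222 _ hx _ hw)).2]
    · rw [h.q2 hw hb.1 hz, (hb.2.2 _ hz).1, zero_mul]
    · rw [h.q4 hw hb.1 hz, (hb.2.2 _ hz).1, zero_mul, neg_zero]
  have hI : IsIdealSet (B : Set R) := by
    refine ⟨B.zero_mem, fun a ha b hb => B.add_mem ha hb, fun a ha => B.neg_mem ha, ?_⟩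
    intro r b hb
    obtain ⟨a, ha, x, hx, y, hy, w, hw, rfl⟩ := h.dec r
    constructor
    · have : (a + x + y + w) * b = w * b := by
        simp only [add_mul]
        rw [h.c1121 _ ha _ hb.1, (hb.2.1 x hx).2, (hb.2.2 y hy).2]
        abel
      rw [this]; exact wB _ hw _ hb
    · have : b * (a + x + y + w) = b * a := by
        simp only [mul_add]
        rw [(hb.2.1 x hx).1, (hb.2.2 y hy).1, h.c2122 _ hb.1 _ hw]
        abel
      rw [this]; exact Br _ ha _ hb
  have htB : t ∈ B := ⟨ht, h1, h2⟩
  exact hne (ann h.alt h.prime _ hI t htB hne t fun i hi => ((hi : i ∈ B).2.2 t ht).1)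

lemma z21 (h : Pe p11 p12 p21 p22) (n12 : ∀ x ∈ p12, x = 0) : ∀ y ∈ p21, y = 0 := by
  intro y hy
  refine h.T21 hy (fun x hx => ?_) (fun z hz => ⟨n12 _ (h.c2121 _ hy _ hz), n12 _ (h.c2121 _ hz _ hy)⟩)
  rw [n12 x hx]; exact ⟨mul_zero _, zero_mul _⟩

/-- Diagonal elements commuting with `p12` are central. -/
lemma central (h : Pe p11 p12 p21 p22) (n12 : ∃ x ∈ p12, x ≠ 0) {a d : R} (ha : a ∈ p11)
    (hd : d ∈ p22) (hc : ∀ x ∈ p12, a * x = x * d) : a + d ∈ rctr R := by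
  have k11 : ∀ r ∈ p11, a * r = r * a := by
    intro r hr
    rw [← sub_eq_zero]
    refine h.A11 n12 (p11.sub_mem (h.c1111 _ ha _ hr) (h.c1111 _ hr _ ha)) fun x hx => ?_
    rw [sub_mul, h.as111112 ha hr hx, h.as111112 hr ha hx, hc x hx, hc _ (h.c1112 _ hr _ hx),
      h.as111222 hr hx hd, sub_self]
  have k22 : ∀ r ∈ p22, d * r = r * d := by
    intro r hr
    rw [← sub_eq_zero]
    refine h.A22 n12 (p22.sub_mem (h.c2222 _ hd _ hr) (h.c2222 _ hr _ hd)) fun x hx => ?_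
    rw [mul_sub, ← h.swap.as211111 hd hr hx, ← h.swap.as211111 hr hd hx, ← hc x hx,
      ← hc _ (h.c1222 _ hx _ hr), h.as111222 ha hx hr, sub_self]
  have k21 : ∀ y ∈ p21, d * y = y * a := by
    intro y hy
    rw [← sub_eq_zero]
    refine h.T21 (p21.sub_mem (h.c2221 _ hd _ hy) (h.c2111 _ hy _ ha)) (fun x hx => ⟨?_, ?_⟩)
      (fun z hz => ⟨?_, ?_⟩)
    · rw [sub_mul, h.swap.as111221 hd hy hx, h.as211112 ha hx hy, hc x hx,
        ← h.swap.as122111 hd hy hx, k22 _ (h.c2112 _ hy _ hx), sub_self]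
    · rw [mul_sub, ← h.swap.as211112 hd hy hx, ← h.as122111 ha hx hy, ← hc x hx,
        h.as111221 ha hx hy, k11 _ (h.c1221 _ hx _ hy), sub_self]
    · rw [sub_mul, h.q2 hd hy hz, h.q1 ha hy hz, hc _ (h.c2121 _ hy _ hz), sub_self]
    · rw [mul_sub, h.q4 hd hy hz, h.q3 ha hy hz, hc _ (h.c2121 _ hy _ hz), sub_self]
  intro r
  obtain ⟨r1, h1, x, hx, y, hy, w, hw, rfl⟩ := h.dec r
  simp only [add_mul, mul_add]
  rw [k11 r1 h1, k22 w hw, k21 y hy, hc x hx, h.c1121 _ ha _ hy, h.c1122 _ ha _ hw,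
    h.c2211 _ hd _ h1, h.c2212 _ hd _ hx, h.c1122 _ h1 _ hd, h.c1211 _ hx _ ha, h.c2122 _ hy _ hd,
    h.c2211 _ hw _ ha]
  abel

end Pe
end ids

section peirce
variable {R : Type*} [NonUnitalNonAssocRing R]

def q11 (e : R) : AddSubgroup R where
  carrier := {x | e * x = x ∧ x * e = x}
  zero_mem' := ⟨mul_zero e, zero_mul e⟩
  add_mem' := fun ha hb => ⟨by rw [mul_add, ha.1, hb.1], by rw [add_mul, ha.2, hb.2]⟩
  neg_mem' := fun ha => ⟨by rw [mul_neg, ha.1], by rw [neg_mul, ha.2]⟩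

def q12 (e : R) : AddSubgroup R where
  carrier := {x | e * x = x ∧ x * e = 0}
  zero_mem' := ⟨mul_zero e, zero_mul e⟩
  add_mem' := fun ha hb => ⟨by rw [mul_add, ha.1, hb.1], by rw [add_mul, ha.2, hb.2, add_zero]⟩
  neg_mem' := fun ha => ⟨by rw [mul_neg, ha.1], by rw [neg_mul, ha.2, neg_zero]⟩

def q21 (e : R) : AddSubgroup R where
  carrier := {x | e * x = 0 ∧ x * e = x}
  zero_mem' := ⟨mul_zero e, zero_mul e⟩
  add_mem' := fun ha hb => ⟨by rw [mul_add, ha.1, hb.1, add_zero], by rw [add_mul, ha.2, hb.2]⟩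
  neg_mem' := fun ha => ⟨by rw [mul_neg, ha.1, neg_zero], by rw [neg_mul, ha.2]⟩

def q22 (e : R) : AddSubgroup R where
  carrier := {x | e * x = 0 ∧ x * e = 0}
  zero_mem' := ⟨mul_zero e, zero_mul e⟩
  add_mem' := fun ha hb => ⟨by rw [mul_add, ha.1, hb.1, add_zero],
    by rw [add_mul, ha.2, hb.2, add_zero]⟩
  neg_mem' := fun ha => ⟨by rw [mul_neg, ha.1, neg_zero], by rw [neg_mul, ha.2, neg_zero]⟩

lemma eL (h : IsAlt R) (e x y : R) : e * (x * y) = (e * x) * y + (x * e) * y - x * (e * y) := by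
  have := sw1 h e x y
  rw [← sub_eq_zero, ← neg_eq_zero, ← this]; abel

lemma eR (h : IsAlt R) (e x y : R) : (x * y) * e = x * (y * e) + x * (e * y) - (x * e) * y := by
  have := sw2 h x y e
  rw [← sub_eq_zero, ← this]; abel

lemma eM (h : IsAlt R) (e x y : R) : (x * e) * y - x * (e * y) = y * (e * x) - (y * e) * x := by
  have h1 := cyc h x e y
  have h2 := sw2 h e y x
  have h3 := cyc h y e x
  rw [h1, ← neg_sub ((y * e) * x), h3]
  exact eq_neg_of_add_eq_zero_left h2

lemma z1122 (h : IsAlt R) (e : R) (he : e * e = e) {x y : R} (hx : x ∈ q11 e) (hy : y ∈ q22 e) :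
    x * y = 0 ∧ y * x = 0 := by
  have h1 := eL h e x y
  have h2 := eM h e x y
  have h3 := eL h e y x
  have h4 := (h e (x * y)).1
  rw [hx.2, hy.1, hy.2, hx.1] at h2
  rw [hx.1, hx.2, hy.1] at h1
  rw [hx.1, hy.1, hy.2] at h3
  simp only [mul_zero, zero_mul, sub_zero, zero_sub, add_zero] at h1 h2 h3
  rw [← h2] at h3 ⊢
  rw [he, h1, mul_add, h1] at h4
  rw [h1] at h3
  have h5 : x * y + x * y = 0 := by simpa using h4
  rw [h5] at h3
  have : x * y = 0 := by simpa using h3.symm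
  exact ⟨this, this⟩

lemma peirce (h : IsAlt R) (hp : IsPrimeRing R) (e : R) (he : e * e = e) :
    Pe (q11 e) (q12 e) (q21 e) (q22 e) := by
  have l1 : ∀ x, e * (e * x) = e * x := fun x => by rw [← (h e x).1, he]
  have l2 : ∀ x, (x * e) * e = x * e := fun x => by rw [(h e x).2, he]
  have l3 : ∀ x, (e * x) * e = e * (x * e) := fun x => by
    have h1 := cyc h x e e
    have h2 := cyc h e e x
    rw [l2, he, sub_self] at h1
    have h3 := cyc h e x e
    rw [l2, he, sub_self] at h3
    exact sub_eq_zero.1 h3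
  refine ⟨h, hp, ?_, ?_, ?_, ?_, ?_, ?_, ?_, ?_, ?_, ?_, ?_, ?_, ?_, ?_, ?_, ?_, ?_⟩
  · intro r
    refine ⟨e * (r * e), ⟨?_, ?_⟩, e * r - e * (r * e), ⟨?_, ?_⟩, r * e - e * (r * e), ⟨?_, ?_⟩,
      r - e * r - r * e + e * (r * e), ⟨?_, ?_⟩, by abel⟩ <;>
    simp [mul_sub, sub_mul, mul_add, add_mul, l1, l2, l3]
  all_goals intro x hx y hy
  on_goal 4 => exact (z1122 h e he hx hy).1
  on_goal 12 => exact (z1122 h e he hy hx).2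
  all_goals
    have hx1 := hx.1
    have hx2 := hx.2
    have hy1 := hy.1
    have hy2 := hy.2
    have a1 := eL h e x y
    have a2 := eR h e x y
    have a3 := eM h e x y
    rw [hx1, hx2, hy1] at a1
    rw [hx2, hy1, hy2] at a2
    rw [hx2, hy1, hy2, hx1] at a3
    simp only [mul_zero, zero_mul, sub_zero, zero_sub, add_zero, zero_add, sub_self,
      add_sub_cancel_right] at a1 a2 a3
    first
      | exact ⟨a1, a2⟩
      | exact a3
      | exact neg_eq_zero.1 a3

lemma nd (h : IsAlt R) (hp : IsPrimeRing R) (e : R) (he : e * e = e) (hne : e ≠ 0)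
    (hnu : ¬ ∀ x : R, e * x = x ∧ x * e = x) (h12 : ∀ x ∈ q12 e, x = 0)
    (h21 : ∀ x ∈ q21 e, x = 0) : False := by
  have P := peirce h hp e he
  have hI : IsIdealSet ((q11 e : AddSubgroup R) : Set R) := by
    refine ⟨(q11 e).zero_mem, fun a ha b hb => (q11 e).add_mem ha hb,
      fun a ha => (q11 e).neg_mem ha, ?_⟩
    intro r s hs
    obtain ⟨a, ha, x, hx, y, hy, w, hw, rfl⟩ := P.dec r
    rw [h12 x hx, h21 y hy]
    simp only [add_zero, add_mul, mul_add]
    rw [P.c2211 w hw s hs, P.c1122 s hs w hw, add_zero, add_zero]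
    exact ⟨P.c1111 _ ha _ hs, P.c1111 _ hs _ ha⟩
  apply hnu
  intro r
  obtain ⟨a, ha, x, hx, y, hy, w, hw, rfl⟩ := P.dec r
  have : w = 0 := ann h hp _ hI e (⟨he, he⟩ : e ∈ q11 e) hne w fun i hi => P.c1122 i hi w hw
  rw [h12 x hx, h21 y hy, this, add_zero, add_zero, add_zero]
  exact ha

end peirce

section main
variable {R : Type*} [NonUnitalNonAssocRing R]

/-- commutator -/
def br (x y : R) : R := x * y - y * x

lemma br_add_left (x y z : R) : br (x + y) z = br x z + br y z := by
  simp only [br, add_mul, mul_add]; abel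
lemma br_add_right (x y z : R) : br x (y + z) = br x y + br x z := by
  simp only [br, add_mul, mul_add]; abel
lemma br_neg_left (x z : R) : br (-x) z = - br x z := by
  simp only [br, neg_mul, mul_neg]; abel
lemma br_neg_right (x z : R) : br x (-z) = - br x z := by
  simp only [br, neg_mul, mul_neg]; abel
lemma br_zero_left (z : R) : br 0 z = 0 := by simp [br]
lemma br_zero_right (z : R) : br z 0 = 0 := by simp [br]
lemma br_sub_left (x y z : R) : br (x - y) z = br x z - br y z := by
  rw [sub_eq_add_neg, br_add_left, br_neg_left, sub_eq_add_neg]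
lemma br_ctr_left {w : R} (hw : w ∈ rctr R) (z : R) : br w z = 0 := sub_eq_zero.2 (hw z)
lemma br_ctr_right {w : R} (hw : w ∈ rctr R) (z : R) : br z w = 0 := sub_eq_zero.2 (hw z).symm

lemma ctr_add {v w : R} (hv : v ∈ rctr R) (hw : w ∈ rctr R) : v + w ∈ rctr R := fun x => by
  rw [add_mul, mul_add, hv x, hw x]

/-- almost additivity at a pair -/
def Q (D : R → R) (a b : R) : Prop := ∃ w ∈ rctr R, D (a + b) = D a + D b + w

lemma Q_of {D : R → R} {a b : R} (h : D (a + b) - D a - D b ∈ rctr R) : Q D a b :=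
  ⟨_, h, by abel⟩

/-- multiplicative Lie triple derivation -/
def Tri (D : R → R) : Prop := ∀ x y z : R,
  D (br (br x y) z) = br (br (D x) y) z + br (br x (D y)) z + br (br x y) (D z)

lemma Tri.zero {D : R → R} (hD : Tri D) : D 0 = 0 := by
  have := hD 0 0 0
  simpa [br_zero_left, br_zero_right] using this

lemma Tri.del {D : R → R} (hD : Tri D) (a b y z : R) :
    br (br (D (a + b) - D a - D b) y) z =
      D (br (br a y) z + br (br b y) z) - D (br (br a y) z) - D (br (br b y) z) := by
  rw [← br_add_left, ← br_add_left, hD, hD, hD]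
  simp only [br_sub_left, br_add_left]
  abel

lemma Tri.quad {D : R → R} (hD : Tri D) {x x' y y' : R} (z : R) (hx : Q D x x') (hy : Q D y y') :
    D (br (br x y) z + br (br x y') z + (br (br x' y) z + br (br x' y') z)) =
      D (br (br x y) z) + D (br (br x y') z) + (D (br (br x' y) z) + D (br (br x' y') z)) := by
  obtain ⟨w, hw, hx⟩ := hx
  obtain ⟨v, hv, hy⟩ := hy
  have : br (br x y) z + br (br x y') z + (br (br x' y) z + br (br x' y') z)
      = br (br (x + x') (y + y')) z := by
    simp only [br_add_left, br_add_right]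
    abel
  rw [this, hD, hD, hD, hD, hD, hx, hy]
  simp only [br_add_left, br_add_right, br_ctr_left hw, br_ctr_right hv, br_zero_left]
  abel

lemma b12 {e x : R} (hx : x ∈ q12 e) : br x e = -x := by rw [br, hx.1, hx.2, zero_sub]
lemma b21 {e x : R} (hx : x ∈ q21 e) : br x e = x := by rw [br, hx.1, hx.2, sub_zero]
lemma b12' {e x : R} (hx : x ∈ q12 e) : br e x = x := by rw [br, hx.1, hx.2, sub_zero]
lemma b21' {e x : R} (hx : x ∈ q21 e) : br e x = -x := by rw [br, hx.1, hx.2, zero_sub]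

/-- diagonal elements -/
def dg (e : R) : AddSubgroup R := q11 e ⊔ q22 e

section
variable {e : R} (P : Pe (q11 e) (q12 e) (q21 e) (q22 e))
include P

omit P in
lemma bdg {d : R} (hd : d ∈ dg e) : br d e = 0 := by
  obtain ⟨a, ha, b, hb, rfl⟩ := AddSubgroup.mem_sup.1 hd
  rw [br, add_mul, mul_add, ha.1, ha.2, hb.1, hb.2, sub_self]

lemma bd12 {d x : R} (hd : d ∈ dg e) (hx : x ∈ q12 e) : br d x ∈ q12 e := by
  obtain ⟨a, ha, b, hb, rfl⟩ := AddSubgroup.mem_sup.1 hd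
  rw [br, add_mul, mul_add, P.c2212 _ hb _ hx, P.c1211 _ hx _ ha, add_zero, zero_add]
  exact (q12 e).sub_mem (P.c1112 _ ha _ hx) (P.c1222 _ hx _ hb)

lemma bd21 {d x : R} (hd : d ∈ dg e) (hx : x ∈ q21 e) : br d x ∈ q21 e := by
  obtain ⟨a, ha, b, hb, rfl⟩ := AddSubgroup.mem_sup.1 hd
  rw [br, add_mul, mul_add, P.c1121 _ ha _ hx, P.c2122 _ hx _ hb, add_zero, zero_add]
  exact (q21 e).sub_mem (P.c2221 _ hb _ hx) (P.c2111 _ hx _ ha)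

lemma b1221 {x y : R} (hx : x ∈ q12 e) (hy : y ∈ q21 e) : br x y ∈ dg e :=
  (dg e).sub_mem (AddSubgroup.mem_sup_left (P.c1221 _ hx _ hy))
    (AddSubgroup.mem_sup_right (P.c2112 _ hy _ hx))

lemma b2112 {x y : R} (hx : x ∈ q12 e) (hy : y ∈ q21 e) : br y x ∈ dg e :=
  (dg e).sub_mem (AddSubgroup.mem_sup_right (P.c2112 _ hy _ hx))
    (AddSubgroup.mem_sup_left (P.c1221 _ hx _ hy))

lemma b1212 {x y : R} (hx : x ∈ q12 e) (hy : y ∈ q12 e) : br x y ∈ q21 e :=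
  (q21 e).sub_mem (P.c1212 _ hx _ hy) (P.c1212 _ hy _ hx)

lemma b2121 {x y : R} (hx : x ∈ q21 e) (hy : y ∈ q21 e) : br x y ∈ q12 e :=
  (q12 e).sub_mem (P.c2121 _ hx _ hy) (P.c2121 _ hy _ hx)

lemma T_dg {T : R} (h : br (br T e) e = 0) : ∃ a ∈ q11 e, ∃ d ∈ q22 e, T = a + d := by
  obtain ⟨a, ha, x, hx, y, hy, w, hw, rfl⟩ := P.dec T
  have h0 : a + x + y + w = (a + w) + x + y := by abel
  have hd : a + w ∈ dg e :=
    AddSubgroup.add_mem _ (AddSubgroup.mem_sup_left ha) (AddSubgroup.mem_sup_right hw)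
  rw [h0] at h
  simp only [br_add_left, bdg hd, b12 hx, b21 hy, br_neg_left, br_zero_left, neg_neg,
    zero_add] at h
  have hx0 : x = 0 := by
    have := congrArg (e * ·) h
    simpa [mul_add, hx.1, hy.1] using this
  have hy0 : y = 0 := by simpa [hx0] using h
  exact ⟨a, ha, w, hw, by rw [hx0, hy0]; abel⟩

lemma T_ctr12 (n12 : ∃ x ∈ q12 e, x ≠ 0) {T : R} (h : br (br T e) e = 0)
    (h' : ∀ x ∈ q12 e, br (br T x) e = 0) : T ∈ rctr R := by
  obtain ⟨a, ha, d, hd, rfl⟩ := T_dg P h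
  refine P.central n12 ha hd fun x hx => ?_
  have hdd : a + d ∈ dg e :=
    AddSubgroup.add_mem _ (AddSubgroup.mem_sup_left ha) (AddSubgroup.mem_sup_right hd)
  have := h' x hx
  rw [b12 (bd12 P hdd hx), neg_eq_zero, br, add_mul, mul_add, P.c2212 _ hd _ hx,
    P.c1211 _ hx _ ha, add_zero, zero_add] at this
  exact sub_eq_zero.1 this

lemma T_ctr21 (n21 : ∃ x ∈ q21 e, x ≠ 0) {T : R} (h : br (br T e) e = 0)
    (h' : ∀ x ∈ q21 e, br (br T x) e = 0) : T ∈ rctr R := by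
  obtain ⟨a, ha, d, hd, rfl⟩ := T_dg P h
  rw [add_comm]
  refine P.swap.central n21 hd ha fun x hx => ?_
  have hdd : a + d ∈ dg e :=
    AddSubgroup.add_mem _ (AddSubgroup.mem_sup_left ha) (AddSubgroup.mem_sup_right hd)
  have := h' x hx
  rw [b21 (bd21 P hdd hx), br, add_mul, mul_add, P.c1121 _ ha _ hx,
    P.c2122 _ hx _ hd, add_zero, zero_add] at this
  exact sub_eq_zero.1 this

variable {D : R → R} (hD : Tri D) (n12 : ∃ x ∈ q12 e, x ≠ 0) (n21 : ∃ x ∈ q21 e, x ≠ 0)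
include hD n12 n21

omit n12 in
lemma claim1 {d a : R} (hd : d ∈ dg e) (ha : a ∈ q12 e) : Q D d a := by
  apply Q_of
  refine T_ctr21 P n21 ?_ fun x hx => ?_
  · rw [hD.del, bdg hd, br_zero_left, zero_add, hD.zero, sub_zero, sub_self]
  · rw [hD.del, bdg (b1221 P ha hx), add_zero, hD.zero, sub_zero, sub_self]

omit n21 in
lemma claim1' {d a : R} (hd : d ∈ dg e) (ha : a ∈ q21 e) : Q D d a := by
  apply Q_of
  refine T_ctr12 P n12 ?_ fun x hx => ?_
  · rw [hD.del, bdg hd, br_zero_left, zero_add, hD.zero, sub_zero, sub_self]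
  · rw [hD.del, bdg (b2112 P hx ha), add_zero, hD.zero, sub_zero, sub_self]

lemma claim2 (he : e ∈ dg e) {p q : R} (hp : p ∈ q12 e) (hq : q ∈ q21 e) :
    D (p + q) = D p + D q := by
  have hq' := (q21 e).neg_mem hq
  have := hD.quad e (claim1 P hD n21 he hp) (claim1' P hD n12 he hq')
  rw [bdg he, br_zero_left, b21' hq', neg_neg, b21 hq, b12 hp, br_neg_left, b12 hp, neg_neg,
    bdg (b1221 P hp hq'), hD.zero] at this
  simp only [zero_add, add_zero] at this
  rw [add_comm, this, add_comm]

lemma claim4 (he : e ∈ dg e) {a b : R} (ha : a ∈ q12 e) (hb : b ∈ q12 e) :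
    D (a + b) = D a + D b := by
  have hb' := (q12 e).neg_mem hb
  have := hD.quad e (claim1 P hD n21 he ha) (claim1 P hD n21 he hb')
  rw [bdg he, br_zero_left, b12' hb', br_neg_left, b12 hb, neg_neg, b12 ha, br_neg_left, b12 ha,
    neg_neg, b21 (b1212 P ha hb'), hD.zero] at this
  simp only [zero_add, ← add_assoc] at this
  rw [claim2 P hD n12 n21 he ((q12 e).add_mem hb ha) (b1212 P ha hb')] at this
  rw [add_comm, add_right_cancel this, add_comm]

lemma claim4' (he : e ∈ dg e) {a b : R} (ha : a ∈ q21 e) (hb : b ∈ q21 e) :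
    D (a + b) = D a + D b := by
  have hb' := (q21 e).neg_mem hb
  have hc := (q12 e).neg_mem (b2121 P ha hb')
  have := hD.quad e (claim1' P hD n12 he ha) (claim1' P hD n12 he hb')
  rw [bdg he, br_zero_left, b21' hb', neg_neg, b21 hb, b21 ha, b21 ha,
    b12 (b2121 P ha hb'), hD.zero] at this
  simp only [zero_add, ← add_assoc] at this
  rw [add_comm (b + a), claim2 P hD n12 n21 he hc ((q21 e).add_mem hb ha), add_comm (D (-_))] at this
  rw [add_comm, add_right_cancel this, add_comm]

lemma claim3 (he : e ∈ dg e) {d p q : R} (hd : d ∈ dg e) (hp : p ∈ q12 e) (hq : q ∈ q21 e) :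
    Q D d (p + q) := by
  apply Q_of
  refine T_ctr12 P n12 ?_ fun x hx => ?_
  · rw [hD.del, bdg hd, br_zero_left, zero_add, hD.zero, sub_zero, sub_self]
  · rw [hD.del, b12 (bd12 P hd hx), br_add_left, br_add_left, bdg (b2112 P hx hq), add_zero,
      b21 (b1212 P hp hx), claim2 P hD n12 n21 he ((q12 e).neg_mem (bd12 P hd hx)) (b1212 P hp hx)]
    abel

lemma claim5 (he : e ∈ dg e) {d d' : R} (hd : d ∈ dg e) (hd' : d' ∈ dg e) : Q D d d' := by
  apply Q_of
  refine T_ctr12 P n12 ?_ fun x hx => ?_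
  · rw [hD.del, bdg hd, bdg hd', br_zero_left, add_zero, hD.zero, sub_zero, sub_zero]
  · rw [hD.del, b12 (bd12 P hd hx), b12 (bd12 P hd' hx), claim4 P hD n12 n21 he
      ((q12 e).neg_mem (bd12 P hd hx)) ((q12 e).neg_mem (bd12 P hd' hx))]
    abel

lemma final (he : e ∈ dg e) (a b : R) : Q D a b := by
  obtain ⟨a1, ha1, p, hp, q, hq, a2, ha2, rfl⟩ := P.dec a
  obtain ⟨b1, hb1, p', hp', q', hq', b2, hb2, rfl⟩ := P.dec b
  have hd : a1 + a2 ∈ dg e :=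
    AddSubgroup.add_mem _ (AddSubgroup.mem_sup_left ha1) (AddSubgroup.mem_sup_right ha2)
  have hd' : b1 + b2 ∈ dg e :=
    AddSubgroup.add_mem _ (AddSubgroup.mem_sup_left hb1) (AddSubgroup.mem_sup_right hb2)
  have e1 : a1 + p + q + a2 = (a1 + a2) + (p + q) := by abel
  have e2 : b1 + p' + q' + b2 = (b1 + b2) + (p' + q') := by abel
  rw [e1, e2]
  generalize a1 + a2 = d at *
  generalize b1 + b2 = d' at *
  obtain ⟨w1, hw1, h1⟩ := claim3 P hD n12 n21 he hd hp hq
  obtain ⟨w2, hw2, h2⟩ := claim3 P hD n12 n21 he hd' hp' hq'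
  obtain ⟨w3, hw3, h3⟩ := claim5 P hD n12 n21 he hd hd'
  obtain ⟨w4, hw4, h4⟩ := claim3 P hD n12 n21 he ((dg e).add_mem hd hd')
    ((q12 e).add_mem hp hp') ((q21 e).add_mem hq hq')
  have e3 : d + (p + q) + (d' + (p' + q')) = (d + d') + ((p + p') + (q + q')) := by abel
  have neg : ∀ w : R, w ∈ rctr R → -w ∈ rctr R := fun w hw x => by
    rw [neg_mul, mul_neg, hw x]
  refine ⟨w3 + w4 + -w1 + -w2,
    ctr_add (ctr_add (ctr_add hw3 hw4) (neg _ hw1)) (neg _ hw2), ?_⟩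
  rw [e3, h4, h3, h1, h2,
    claim2 P hD n12 n21 he ((q12 e).add_mem hp hp') ((q21 e).add_mem hq hq'),
    claim2 P hD n12 n21 he hp hq, claim2 P hD n12 n21 he hp' hq',
    claim4 P hD n12 n21 he hp hp', claim4' P hD n12 n21 he hq hq']
  abel

end
end main
end LieAlt

theorem stmt7 {R : Type*} [NonUnitalNonAssocRing R] (halt : IsAlt R)
    (htor3 : ∀ x : R, (3 : ℕ) • x = 0 → x = 0)
    (hprime : IsPrimeRing R)
    (e₁ : R) (he : e₁ * e₁ = e₁) (hne : e₁ ≠ 0)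
    (hnu : ¬ ∀ x : R, e₁ * x = x ∧ x * e₁ = x)
    (D : R → R)
    (hD : ∀ x y z : R,
      D ((x * y - y * x) * z - z * (x * y - y * x)) =
        ((D x * y - y * D x) * z - z * (D x * y - y * D x)) +
        ((x * D y - D y * x) * z - z * (x * D y - D y * x)) +
        ((x * y - y * x) * D z - D z * (x * y - y * x))) :
    ∀ a b : R, ∃ w ∈ rctr R, D (a + b) = D a + D b + w := by
  have P := LieAlt.peirce halt hprime e₁ he
  have n12 : ∃ x ∈ LieAlt.q12 e₁, x ≠ 0 := by
    by_contra hc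
    push Not at hc
    exact LieAlt.nd halt hprime e₁ he hne hnu hc (P.z21 hc)
  have n21 : ∃ x ∈ LieAlt.q21 e₁, x ≠ 0 := by
    by_contra hc
    push Not at hc
    exact LieAlt.nd halt hprime e₁ he hne hnu (P.swap.z21 hc) hc
  have hT : LieAlt.Tri D := hD
  exact LieAlt.final P hT n12 n21
    (AddSubgroup.mem_sup_left (⟨he, he⟩ : e₁ ∈ LieAlt.q11 e₁))
end
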